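/- Let A be a finite arrangement of affine hyperplanes in ℂ^ℓ and M(A) = ℂ^ℓ ∖ ⋃_{H∈A} H its complement. Then for every i, the i-th topological Betti number of M(A) (the dimension over ℚ of the i-th singular homology of M(A) with rational coefficients) equals the combinatorially defined number b_i(A); equivalently, the topological Poincaré polynomial of M(A) equals π(A,t). -/

import Mathlib

open scoped Classical

noncomputable section

variable (K : Type) [Field K] {V : Type} [AddCommGroup V] [Module K V]

/-- An affine hyperplane in `V`: the level set of a nonzero linear functional. -/
def IsHyperplane (H : Set V) : Prop :=
  ∃ (f : V →ₗ[K] K) (c : K), f ≠ 0 ∧ H = {x | f x = c}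

/-- The dimension of a subset of `V`: the dimension of its affine span. -/
def flatDim (X : Set V) : ℕ := Module.finrank K (affineSpan K X).direction

/-- The intersection poset `L(A)` of the arrangement `A` inside the ambient set `W`:
all nonempty intersections of subfamilies of `A` (intersected with the ambient `W`),
the empty subfamily giving `W` itself. -/
def interPosetIn (W : Set V) (A : Finset (Set V)) : Finset (Set V) :=
  (A.powerset.image fun S => W ∩ ⋂ H ∈ S, H).filter fun X => X.Nonempty

/-- The rank of `X`: its codimension within the ambient space `W`. -/
def rkIn (W X : Set V) : ℕ := flatDim K W - flatDim K X

/-- `μ` satisfies the defining recursion of the Möbius function of the poset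
`L(A)` inside the ambient set `W`.  `L(A)` is ordered by reverse inclusion, so the
condition `μ(W) = 1`, `μ(X) = -∑_{Y < X} μ(Y)` for `X > W` is equivalent to:
for every `X ∈ L(A)`, `∑_{Y ⊇ X} μ(Y)` is `1` if `X = W` and `0` otherwise. -/
def IsMobiusIn (W : Set V) (A : Finset (Set V)) (μ : Set V → ℤ) : Prop :=
  ∀ X ∈ interPosetIn W A,
    (∑ Y ∈ (interPosetIn W A).filter fun Y => X ⊆ Y, μ Y) = if X = W then 1 else 0

/-- The Poincaré polynomial `π(A,t) = ∑_{X ∈ L(A)} μ(X) (-t)^{r(X)}`. -/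
def poinIn (W : Set V) (A : Finset (Set V)) (μ : Set V → ℤ) : Polynomial ℤ :=
  ∑ X ∈ interPosetIn W A, Polynomial.C (μ X) * (- Polynomial.X) ^ (rkIn K W X)

/-- A chamber of the arrangement `A` within the ambient set `W`: a connected
component of `W ∖ ⋃_{H ∈ A} H`. -/
def IsChamberIn [TopologicalSpace V] (W : Set V) (A : Finset (Set V)) (C : Set V) : Prop :=
  ∃ x ∈ W ∩ (⋃ H ∈ A, (H : Set V))ᶜ, C = connectedComponentIn (W ∩ (⋃ H ∈ A, (H : Set V))ᶜ) x

/-- `F` is a generic (transversal) `q`-dimensional affine subspace for the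
arrangement `A`: it is (the carrier of) an affine subspace of dimension `q`, and
for every `X ∈ L(A)`, if `r(X) ≤ q` then `F ∩ X` is nonempty of dimension
`q - r(X)`, and if `r(X) > q` then `F ∩ X = ∅`. -/
def IsGenericFlat (q : ℕ) (A : Finset (Set V)) (F : Set V) : Prop :=
  (∃ W : AffineSubspace K V, (W : Set V) = F) ∧ F.Nonempty ∧ flatDim K F = q ∧
  ∀ X ∈ interPosetIn Set.univ A,
    (rkIn K Set.univ X ≤ q → (F ∩ X).Nonempty ∧ flatDim K (F ∩ X) = q - rkIn K Set.univ X) ∧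
    (q < rkIn K Set.univ X → F ∩ X = ∅)

end

open CategoryTheory in
/-- Singular homology of a topological space with coefficients in `R`: the homology of
the alternating face map complex of the free simplicial `R`-module on the singular
simplicial set. -/
noncomputable def singularHomologyFunctor (R : Type) [CommRing R] (i : ℕ) :
    TopCat ⥤ ModuleCat R :=
  TopCat.toSSet ⋙ ((SimplicialObject.whiskering _ _).obj (ModuleCat.free R)) ⋙
    AlgebraicTopology.alternatingFaceMapComplex _ ⋙ HomologicalComplex.homologyFunctor _ _ i

noncomputable section

open CategoryTheory Simplicial Opposite

/-- The (unnormalised) rational chain complex of a simplicial set. -/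
def ratChains : SSet.{0} ⥤ ChainComplex (ModuleCat.{0} ℚ) ℕ :=
  (SimplicialObject.whiskering _ _).obj (ModuleCat.free ℚ) ⋙
    AlgebraicTopology.alternatingFaceMapComplex _

/-- Rational `n`-chains of a simplicial set. -/
abbrev Chn (S : SSet.{0}) (n : ℕ) : Type := S _⦋n⦌ →₀ ℚ

namespace Chn

variable {S S' : SSet.{0}}

/-- A simplex, regarded as a chain. -/
def sx (S : SSet.{0}) {n : ℕ} (x : S _⦋n⦌) : Chn S n := Finsupp.single x 1

/-- Linear maps on chains agree if they agree on simplices. -/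
lemma hom_ext {n : ℕ} {M : Type} [AddCommGroup M] [Module ℚ M]
    {f g : Chn S n →ₗ[ℚ] M} (h : ∀ x : S _⦋n⦌, f (sx S x) = g (sx S x)) : f = g :=
  Finsupp.lhom_ext' fun x => LinearMap.ext_ring (h x)

/-- The alternating sum of faces. -/
def bd (S : SSet.{0}) (n : ℕ) : Chn S (n + 1) →ₗ[ℚ] Chn S n :=
  ∑ i : Fin (n + 2), ((-1 : ℤ) ^ (i : ℕ)) • Finsupp.lmapDomain ℚ ℚ (S.δ i)

/-- The map induced on chains by a map of simplicial sets. -/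
def push (f : S ⟶ S') (n : ℕ) : Chn S n →ₗ[ℚ] Chn S' n :=
  Finsupp.lmapDomain ℚ ℚ (f.app (op ⦋n⦌))

lemma bd_sx (n : ℕ) (x : S _⦋n + 1⦌) :
    bd S n (sx S x) = ∑ i : Fin (n + 2), ((-1 : ℤ) ^ (i : ℕ)) • sx S (S.δ i x) := by
  simp [bd, sx, LinearMap.sum_apply]

@[simp] lemma push_sx (f : S ⟶ S') (n : ℕ) (x : S _⦋n⦌) :
    push f n (sx S x) = sx S' (f.app (op ⦋n⦌) x) := by
  simp [push, sx]

lemma ratChains_d (S : SSet.{0}) (n : ℕ) :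
    ((ratChains.obj S).d (n + 1) n).hom = bd S n := by
  refine LinearMap.ext fun c => ?_
  simp only [ratChains, Functor.comp_obj, AlgebraicTopology.alternatingFaceMapComplex_obj_d,
    AlgebraicTopology.AlternatingFaceMapComplex.objD, bd]
  rw [ModuleCat.hom_sum]
  simp
  rfl

lemma ratChains_map (f : S ⟶ S') (n : ℕ) :
    ((ratChains.map f).f n).hom = push f n := rfl

lemma bd_bd (n : ℕ) (c : Chn S (n + 2)) : bd S n (bd S (n + 1) c) = 0 := by
  rw [← ratChains_d, ← ratChains_d]
  have := (ratChains.obj S).d_comp_d (n + 2) (n + 1) n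
  exact congrArg (fun f => f.hom c) this

lemma push_bd (f : S ⟶ S') (n : ℕ) (c : Chn S (n + 1)) :
    push f n (bd S n c) = bd S' n (push f (n + 1) c) := by
  rw [← ratChains_d, ← ratChains_d, ← ratChains_map, ← ratChains_map]
  have := (ratChains.map f).comm (n + 1) n
  exact (congrArg (fun f => f.hom c) this).symm

end Chn

/-- The simplicial set with all tuples of points of `K` as simplices. -/
def tuples (K : Type) : SSet.{0} where
  obj n := Fin (n.unop.len + 1) → K
  map f := TypeCat.ofHom fun v => v ∘ f.unop.toOrderHom

namespace Subdiv

open Chn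

variable {K K' : Type}

/-- A tuple of points, regarded as a simplex. -/
def tup {n : ℕ} (v : Fin (n + 1) → K) : (tuples K) _⦋n⦌ := v

/-- Linear maps on chains of tuples agree if they agree on tuples. -/
lemma tuples_hom_ext {n : ℕ} {M : Type} [AddCommGroup M] [Module ℚ M]
    {f g : Chn (tuples K) n →ₗ[ℚ] M}
    (h : ∀ v : Fin (n + 1) → K, f (sx (tuples K) (tup v)) = g (sx (tuples K) (tup v))) : f = g :=
  hom_ext h

/-- The map of tuples induced by a map of points. -/
def mapTuples (φ : K → K') : tuples K ⟶ tuples K' where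
  app n := TypeCat.ofHom fun v => φ ∘ v

lemma mapTuples_app (φ : K → K') (n : ℕ) (v : Fin (n + 1) → K) :
    (mapTuples φ).app (op ⦋n⦌) (tup v) = tup (φ ∘ v) := rfl

lemma tuples_δ (n : ℕ) (i : Fin (n + 2)) (v : Fin (n + 2) → K) :
    (tuples K).δ i (tup v) = tup (v ∘ i.succAbove) := rfl

/-- Coning off a chain of tuples with apex `b`. -/
def cone (b : K) (n : ℕ) : Chn (tuples K) n →ₗ[ℚ] Chn (tuples K) (n + 1) :=
  Finsupp.lmapDomain ℚ ℚ fun v : Fin (n + 1) → K => (Fin.cons b v : Fin (n + 2) → K)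

@[simp] lemma cone_sx (b : K) (n : ℕ) (v : Fin (n + 1) → K) :
    cone b n (sx (tuples K) (tup v)) = sx (tuples K) (tup (Fin.cons b v)) :=
  Finsupp.mapDomain_single

lemma bd_cone_sx (b : K) (n : ℕ) (v : Fin (n + 2) → K) :
    bd (tuples K) (n + 1) (cone b (n + 1) (sx (tuples K) (tup v))) =
      sx (tuples K) (tup v) - cone b n (bd (tuples K) n (sx (tuples K) (tup v))) := by
  rw [cone_sx, bd_sx, bd_sx, Fin.sum_univ_succ, map_sum, sub_eq_add_neg,
    ← Finset.sum_neg_distrib]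
  congr 1
  · simp only [Fin.val_zero, pow_zero, one_smul]
    congr 1
  · refine Finset.sum_congr rfl fun i _ => ?_
    rw [map_zsmul, tuples_δ, tuples_δ, cone_sx, Fin.val_succ, pow_succ, mul_neg_one, neg_smul]
    refine congrArg (fun w : Fin (n + 2) → K => -((-1 : ℤ) ^ (i : ℕ) • sx (tuples K) (tup w)))
      (funext fun j => ?_)
    refine Fin.cases ?_ (fun j => ?_) j <;> simp

lemma bd_cone (b : K) (n : ℕ) (c : Chn (tuples K) (n + 1)) :
    bd (tuples K) (n + 1) (cone b (n + 1) c) = c - cone b n (bd (tuples K) n c) := by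
  suffices h : (bd (tuples K) (n + 1)).comp (cone b (n + 1)) =
      LinearMap.id - (cone b n).comp (bd (tuples K) n) from LinearMap.congr_fun h c
  exact tuples_hom_ext fun v => bd_cone_sx b n v

/-- Coning a boundary of one-dimensional chains. -/
lemma bd_cone_bd (b : K) (c : Chn (tuples K) 1) :
    bd (tuples K) 0 (cone b 0 (bd (tuples K) 0 c)) = bd (tuples K) 0 c := by
  have h := congrArg (bd (tuples K) 0) (bd_cone b 0 c)
  rw [bd_bd, map_sub] at h
  exact (sub_eq_zero.1 h.symm).symm

variable (bary : ∀ n : ℕ, (Fin (n + 1) → K) → K) (bary' : ∀ n : ℕ, (Fin (n + 1) → K') → K')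

/-- Barycentric subdivision of chains of tuples, for an abstract barycentre. -/
def sd (n : ℕ) : Chn (tuples K) n →ₗ[ℚ] Chn (tuples K) n :=
  Nat.rec (motive := fun n => Chn (tuples K) n →ₗ[ℚ] Chn (tuples K) n) LinearMap.id
    (fun n f => Finsupp.linearCombination ℚ fun v : Fin (n + 2) → K =>
      cone (bary (n + 1) v) n (f (bd (tuples K) n (sx (tuples K) (tup v))))) n

/-- The chain homotopy from barycentric subdivision to the identity. -/
def htpy (n : ℕ) : Chn (tuples K) n →ₗ[ℚ] Chn (tuples K) (n + 1) :=
  Nat.rec (motive := fun n => Chn (tuples K) n →ₗ[ℚ] Chn (tuples K) (n + 1)) 0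
    (fun n f => Finsupp.linearCombination ℚ fun v : Fin (n + 2) → K =>
      cone (bary (n + 1) v) (n + 1)
        (sx (tuples K) (tup v) - f (bd (tuples K) n (sx (tuples K) (tup v))))) n

lemma sd_zero (c : Chn (tuples K) 0) : sd bary 0 c = c := rfl

lemma sd_sx (n : ℕ) (v : Fin (n + 2) → K) :
    sd bary (n + 1) (sx (tuples K) (tup v)) =
      cone (bary (n + 1) v) n (sd bary n (bd (tuples K) n (sx (tuples K) (tup v)))) :=
  (Finsupp.linearCombination_single ℚ _ _).trans (one_smul _ _)

lemma htpy_sx (n : ℕ) (v : Fin (n + 2) → K) :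
    htpy bary (n + 1) (sx (tuples K) (tup v)) =
      cone (bary (n + 1) v) (n + 1)
        (sx (tuples K) (tup v) - htpy bary n (bd (tuples K) n (sx (tuples K) (tup v)))) :=
  (Finsupp.linearCombination_single ℚ _ _).trans (one_smul _ _)

lemma bd_sd (n : ℕ) (c : Chn (tuples K) (n + 1)) :
    bd (tuples K) n (sd bary (n + 1) c) = sd bary n (bd (tuples K) n c) := by
  suffices h : (bd (tuples K) n).comp (sd bary (n + 1)) = (sd bary n).comp (bd (tuples K) n) from
    LinearMap.congr_fun h c
  clear c
  induction n with
  | zero =>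
    refine tuples_hom_ext fun v => ?_
    simp only [LinearMap.comp_apply]
    rw [sd_sx]
    exact bd_cone_bd _ _
  | succ n ih =>
    refine tuples_hom_ext fun v => ?_
    simp only [LinearMap.comp_apply]
    rw [sd_sx, bd_cone]
    have := LinearMap.congr_fun ih
      (bd (tuples K) (n + 1) (sx (tuples K) (tup v)))
    simp only [LinearMap.comp_apply] at this
    rw [this, bd_bd, map_zero, map_zero, sub_zero]

lemma bd_htpy_zero (c : Chn (tuples K) 0) :
    bd (tuples K) 0 (htpy bary 0 c) = c - sd bary 0 c := by
  simp [htpy, sd_zero]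

lemma bd_htpy (n : ℕ) (c : Chn (tuples K) (n + 1)) :
    bd (tuples K) (n + 1) (htpy bary (n + 1) c) =
      c - sd bary (n + 1) c - htpy bary n (bd (tuples K) n c) := by
  suffices h : (bd (tuples K) (n + 1)).comp (htpy bary (n + 1)) =
      LinearMap.id - sd bary (n + 1) - (htpy bary n).comp (bd (tuples K) n) from
    LinearMap.congr_fun h c
  clear c
  induction n with
  | zero =>
    refine tuples_hom_ext fun v => ?_
    simp only [LinearMap.comp_apply, LinearMap.sub_apply, LinearMap.id_apply]
    rw [htpy_sx, bd_cone, sd_sx, map_sub, bd_htpy_zero]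
    simp only [sub_sub_cancel]
    abel
  | succ n ih =>
    refine tuples_hom_ext fun v => ?_
    simp only [LinearMap.comp_apply, LinearMap.sub_apply, LinearMap.id_apply]
    have := LinearMap.congr_fun ih
      (bd (tuples K) (n + 1) (sx (tuples K) (tup v)))
    simp only [LinearMap.comp_apply, LinearMap.sub_apply, LinearMap.id_apply] at this
    rw [htpy_sx, bd_cone, sd_sx, map_sub, this, bd_bd, map_zero, sub_zero]
    simp only [sub_sub_cancel]
    abel

variable {bary bary'}

lemma push_cone (φ : K → K') (b : K) (n : ℕ) (c : Chn (tuples K) n) :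
    push (mapTuples φ) (n + 1) (cone b n c) = cone (φ b) n (push (mapTuples φ) n c) := by
  suffices h : (push (mapTuples φ) (n + 1)).comp (cone b n) =
      (cone (φ b) n).comp (push (mapTuples φ) n) from LinearMap.congr_fun h c
  refine tuples_hom_ext fun v => ?_
  simp only [LinearMap.comp_apply]
  rw [cone_sx, push_sx, push_sx, mapTuples_app, mapTuples_app, cone_sx]
  refine congrArg (fun w : Fin (n + 2) → K' => sx (tuples K') (tup w)) (funext fun j => ?_)
  refine Fin.cases ?_ (fun j => ?_) j <;> simp

lemma push_sd {φ : K → K'} (hφ : ∀ n v, bary' n (φ ∘ v) = φ (bary n v)) (n : ℕ)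
    (c : Chn (tuples K) n) :
    push (mapTuples φ) n (sd bary n c) = sd bary' n (push (mapTuples φ) n c) := by
  suffices h : (push (mapTuples φ) n).comp (sd bary n) =
      (sd bary' n).comp (push (mapTuples φ) n) from LinearMap.congr_fun h c
  clear c
  induction n with
  | zero => rfl
  | succ n ih =>
    refine tuples_hom_ext fun v => ?_
    simp only [LinearMap.comp_apply]
    have := LinearMap.congr_fun ih (bd (tuples K) n (sx (tuples K) (tup v)))
    simp only [LinearMap.comp_apply] at this
    rw [sd_sx, push_cone, this, push_bd, push_sx, mapTuples_app, sd_sx, hφ]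

lemma push_htpy {φ : K → K'} (hφ : ∀ n v, bary' n (φ ∘ v) = φ (bary n v)) (n : ℕ)
    (c : Chn (tuples K) n) :
    push (mapTuples φ) (n + 1) (htpy bary n c) = htpy bary' n (push (mapTuples φ) n c) := by
  suffices h : (push (mapTuples φ) (n + 1)).comp (htpy bary n) =
      (htpy bary' n).comp (push (mapTuples φ) n) from LinearMap.congr_fun h c
  clear c
  induction n with
  | zero => simp [htpy]
  | succ n ih =>
    refine tuples_hom_ext fun v => ?_
    simp only [LinearMap.comp_apply]
    have := LinearMap.congr_fun ih (bd (tuples K) n (sx (tuples K) (tup v)))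
    simp only [LinearMap.comp_apply] at this
    rw [htpy_sx, push_cone, map_sub, this, push_bd, push_sx, mapTuples_app, htpy_sx,
      hφ]

end Subdiv

end

noncomputable section

open CategoryTheory Simplicial Opposite

/-- The standard topological simplex. -/
abbrev Simp (n : ℕ) : Type := stdSimplex ℝ (Fin (n + 1))

/-- The map of standard simplices induced by a map of vertices. -/
def simpMap {m n : ℕ} (f : Fin (m + 1) → Fin (n + 1)) : C(Simp m, Simp n) :=
  ⟨stdSimplex.map f, stdSimplex.continuous_map f⟩

lemma simpMap_id (n : ℕ) : simpMap (id : Fin (n + 1) → Fin (n + 1)) = ContinuousMap.id _ :=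
  ContinuousMap.ext fun x => stdSimplex.map_id_apply x

lemma simpMap_comp {k m n : ℕ} (g : Fin (m + 1) → Fin (n + 1)) (f : Fin (k + 1) → Fin (m + 1)) :
    simpMap (g ∘ f) = (simpMap g).comp (simpMap f) :=
  ContinuousMap.ext fun x => (stdSimplex.map_comp_apply f g x).symm

/-- The singular simplicial set of a space, with simplices honest continuous maps. -/
def sgObj (E : Type) [TopologicalSpace E] : SSet.{0} where
  obj n := C(Simp n.unop.len, E)
  map f := TypeCat.ofHom fun σ => σ.comp (simpMap f.unop.toOrderHom)
  map_id n := by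
    refine ConcreteCategory.hom_ext _ _ fun (σ : C(_, _)) => ?_
    exact (congrArg σ.comp (simpMap_id _)).trans (ContinuousMap.comp_id σ)
  map_comp f g := by
    refine ConcreteCategory.hom_ext _ _ fun (σ : C(_, _)) => ?_
    exact congrArg σ.comp (simpMap_comp f.unop.toOrderHom g.unop.toOrderHom)

/-- The singular simplicial set functor, with simplices honest continuous maps. -/
def Sg : TopCat.{0} ⥤ SSet.{0} where
  obj E := sgObj E
  map f := { app := fun n => TypeCat.ofHom fun σ => f.hom.comp σ }

/-- `Sg` is the singular simplicial set functor. -/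
def sgIso : Sg ≅ TopCat.toSSet :=
  NatIso.ofComponents
    (fun E => NatIso.ofComponents (fun n => (TopCat.toSSetObjEquiv E n).symm.toIso)
      (fun f => by ext σ; rfl))
    (fun f => by ext n σ; rfl)

/-- Rational homology of a simplicial set. -/
def ssHom (j : ℕ) : SSet.{0} ⥤ ModuleCat.{0} ℚ :=
  ratChains ⋙ HomologicalComplex.homologyFunctor _ _ j

/-- Rational singular homology. -/
def sgHom (j : ℕ) : TopCat.{0} ⥤ ModuleCat.{0} ℚ := Sg ⋙ ssHom j

/-- `sgHom` agrees with the singular homology functor. -/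
def sgHomIso (j : ℕ) : sgHom j ≅ singularHomologyFunctor ℚ j :=
  Functor.isoWhiskerRight sgIso (ssHom j)

/-- Homology of a space. -/
abbrev Hm (j : ℕ) (X : Type) [TopologicalSpace X] : Type :=
  (ratChains.obj (Sg.obj (TopCat.of X))).homology j

/-- The map induced on homology. -/
def hm {X Y : Type} [TopologicalSpace X] [TopologicalSpace Y] (j : ℕ) (f : C(X, Y)) :
    Hm j X →ₗ[ℚ] Hm j Y := ((sgHom j).map (TopCat.ofHom f)).hom

section
variable {X Y Z : Type} [TopologicalSpace X] [TopologicalSpace Y] [TopologicalSpace Z]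

lemma hm_comp (j : ℕ) (g : C(Y, Z)) (f : C(X, Y)) (x : Hm j X) :
    hm j (g.comp f) x = hm j g (hm j f x) := by
  have := (sgHom j).map_comp (TopCat.ofHom f) (TopCat.ofHom g)
  exact congrArg (fun f => f.hom x) this

lemma hm_id (j : ℕ) (x : Hm j X) : hm j (ContinuousMap.id X) x = x := by
  have := (sgHom j).map_id (TopCat.of X)
  exact congrArg (fun f => f.hom x) this

lemma hm_eq_of_homotopic (j : ℕ) {f g : C(X, Y)} (h : f.Homotopic g) : hm j f = hm j g := by
  obtain ⟨h⟩ := h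
  have key : (singularHomologyFunctor ℚ j).map (TopCat.ofHom f) =
      (singularHomologyFunctor ℚ j).map (TopCat.ofHom g) := by
    have h' : TopCat.Homotopy (TopCat.ofHom f) (TopCat.ofHom g) := h
    exact (((h'.toSSet).toSimplicialObjectHomotopy).whiskerRight
      (ModuleCat.free ℚ)).map_homology_eq j
  have key2 : (sgHom j).map (TopCat.ofHom f) = (sgHom j).map (TopCat.ofHom g) := by
    rw [← cancel_mono ((sgHomIso j).hom.app _), (sgHomIso j).hom.naturality,
      (sgHomIso j).hom.naturality, key]
  exact congrArg (fun f => f.hom) key2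
end
end

noncomputable section

open CategoryTheory Simplicial Opposite

/-- The affine map of simplices with prescribed vertices. -/
def aff {m n : ℕ} (v : Fin (m + 1) → Simp n) : C(Simp m, Simp n) where
  toFun x := ⟨∑ i, x.1 i • (v i).1,
    (convex_stdSimplex ℝ (Fin (n + 1))).sum_mem (fun i _ => x.2.1 i) x.2.2 fun i _ => (v i).2⟩
  continuous_toFun := by
    refine Continuous.subtype_mk (continuous_finsetSum _ fun i _ => ?_) _
    exact ((continuous_apply i).comp continuous_subtype_val).smul continuous_const

lemma aff_val {m n : ℕ} (v : Fin (m + 1) → Simp n) (x : Simp m) :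
    (aff v x).1 = ∑ i, x.1 i • (v i).1 := rfl

lemma vertex_val {n : ℕ} (i : Fin (n + 1)) :
    (stdSimplex.vertex i : Simp n).1 = Pi.single i (1 : ℝ) := by
  rfl

lemma aff_vertex_apply {m n : ℕ} (v : Fin (m + 1) → Simp n) (i : Fin (m + 1)) :
    aff v (stdSimplex.vertex i) = v i := by
  refine Subtype.ext ?_
  rw [aff_val, Finset.sum_eq_single i]
  · rw [vertex_val, Pi.single_eq_same, one_smul]
  · intro j _ hj
    rw [vertex_val, Pi.single_eq_of_ne hj, zero_smul]
  · simp

lemma aff_comp {k m n : ℕ} (v : Fin (m + 1) → Simp n) (w : Fin (k + 1) → Simp m) :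
    aff (aff v ∘ w) = (aff v).comp (aff w) := by
  refine ContinuousMap.ext fun x => Subtype.ext ?_
  rw [ContinuousMap.comp_apply, aff_val, aff_val, aff_val]
  simp only [Function.comp_apply, aff_val, Finset.smul_sum]
  rw [Finset.sum_comm]
  refine Finset.sum_congr rfl fun i _ => ?_
  rw [Finset.sum_apply, Finset.sum_smul]
  simp only [smul_smul, Pi.smul_apply, smul_eq_mul]

lemma aff_vertex (n : ℕ) : aff (stdSimplex.vertex : Fin (n + 1) → Simp n) = ContinuousMap.id _ := by
  refine ContinuousMap.ext fun x => Subtype.ext ?_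
  rw [aff_val]
  funext j
  rw [Finset.sum_apply, Finset.sum_eq_single j]
  · rw [vertex_val]
    simp
  · intro i _ hij
    rw [vertex_val]
    simp [hij.symm]
  · simp

lemma simpMap_eq_aff {k m : ℕ} (f : Fin (k + 1) → Fin (m + 1)) :
    simpMap f = aff (stdSimplex.vertex ∘ f : Fin (k + 1) → Simp m) := by
  refine ContinuousMap.ext fun x => Subtype.ext ?_
  rw [aff_val]
  change (stdSimplex.map f x).1 = _
  have h := stdSimplex.map_coe f x
  refine h.trans ?_
  funext j
  rw [FunOnFinite.linearMap_apply_apply, Finset.sum_apply, Finset.sum_filter]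
  refine Finset.sum_congr rfl fun i _ => ?_
  simp only [Function.comp_apply]
  simp [Pi.single_apply, eq_comm]
  rfl

lemma aff_comp_simpMap {k m n : ℕ} (v : Fin (m + 1) → Simp n) (f : Fin (k + 1) → Fin (m + 1)) :
    aff (v ∘ f) = (aff v).comp (simpMap f) := by
  rw [simpMap_eq_aff, ← aff_comp]
  congr 1
  funext i
  exact (aff_vertex_apply v _).symm

namespace Subdiv

open Chn

/-- The barycentre of a tuple of points of a simplex. -/
def bary (n : ℕ) (m : ℕ) (v : Fin (m + 1) → Simp n) : Simp n :=
  aff v stdSimplex.barycenter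

lemma bary_aff {m n : ℕ} (v : Fin (m + 1) → Simp n) (k : ℕ) (w : Fin (k + 1) → Simp m) :
    bary n k (aff v ∘ w) = aff v (bary m k w) := by
  rw [bary, aff_comp]; rfl

variable {E : Type} [TopologicalSpace E]

/-- The affine simplices in a singular simplex. -/
def affIn {n : ℕ} (σ : C(Simp n, E)) : tuples (Simp n) ⟶ sgObj E where
  app m := TypeCat.ofHom fun v => σ.comp (aff v)
  naturality k m f := by
    refine ConcreteCategory.hom_ext _ _ fun v => ?_
    exact congrArg σ.comp (aff_comp_simpMap v f.unop.toOrderHom)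

/-- A continuous map, regarded as a singular simplex. -/
def smp {n : ℕ} (σ : C(Simp n, E)) : (sgObj E) _⦋n⦌ := σ

lemma sg_hom_ext {n : ℕ} {M : Type} [AddCommGroup M] [Module ℚ M]
    {f g : Chn (sgObj E) n →ₗ[ℚ] M}
    (h : ∀ σ : C(Simp n, E), f (sx (sgObj E) (smp σ)) = g (sx (sgObj E) (smp σ))) : f = g :=
  hom_ext h

lemma affIn_app {n m : ℕ} (σ : C(Simp n, E)) (v : Fin (m + 1) → Simp n) :
    (affIn σ).app (op ⦋m⦌) (tup v) = smp (σ.comp (aff v)) := rfl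

lemma affIn_comp {n m : ℕ} (σ : C(Simp n, E)) (v : Fin (m + 1) → Simp n) :
    affIn (σ.comp (aff v)) = mapTuples (aff v) ≫ affIn σ := by
  ext k w
  exact congrArg σ.comp (aff_comp v w).symm

lemma push_comp {S S' S'' : SSet.{0}} (f : S ⟶ S') (g : S' ⟶ S'') (n : ℕ) (c : Chn S n) :
    push (f ≫ g) n c = push g n (push f n c) := by
  rw [← ratChains_map, ← ratChains_map, ← ratChains_map, Functor.map_comp]; rfl

/-- The fundamental chain of the standard simplex. -/
def fund (n : ℕ) : Chn (tuples (Simp n)) n := sx _ (tup stdSimplex.vertex)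

lemma push_affIn_fund {n : ℕ} (σ : C(Simp n, E)) :
    push (affIn σ) n (fund n) = sx (sgObj E) (smp σ) := by
  rw [fund, push_sx, affIn_app, aff_vertex]; rfl

lemma push_mapTuples_fund {n m : ℕ} (v : Fin (m + 1) → Simp n) :
    push (mapTuples (aff v)) m (fund m) = sx (tuples (Simp n)) (tup v) := by
  rw [fund, push_sx, mapTuples_app]
  congr 2
  funext i
  exact aff_vertex_apply v i

variable (E) in
/-- Barycentric subdivision of singular chains. -/
def sgSd (n : ℕ) : Chn (sgObj E) n →ₗ[ℚ] Chn (sgObj E) n :=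
  Finsupp.linearCombination ℚ fun σ : C(Simp n, E) => push (affIn σ) n (sd (bary n) n (fund n))

variable (E) in
/-- The homotopy from barycentric subdivision of singular chains to the identity. -/
def sgHtpy (n : ℕ) : Chn (sgObj E) n →ₗ[ℚ] Chn (sgObj E) (n + 1) :=
  Finsupp.linearCombination ℚ fun σ : C(Simp n, E) =>
    push (affIn σ) (n + 1) (htpy (bary n) n (fund n))

lemma sgSd_sx {n : ℕ} (σ : C(Simp n, E)) :
    sgSd E n (sx (sgObj E) (smp σ)) = push (affIn σ) n (sd (bary n) n (fund n)) :=
  (Finsupp.linearCombination_single ℚ _ _).trans (one_smul _ _)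

lemma sgHtpy_sx {n : ℕ} (σ : C(Simp n, E)) :
    sgHtpy E n (sx (sgObj E) (smp σ)) = push (affIn σ) (n + 1) (htpy (bary n) n (fund n)) :=
  (Finsupp.linearCombination_single ℚ _ _).trans (one_smul _ _)

lemma sgSd_push {n m : ℕ} (σ : C(Simp n, E)) (c : Chn (tuples (Simp n)) m) :
    sgSd E m (push (affIn σ) m c) = push (affIn σ) m (sd (bary n) m c) := by
  suffices h : (sgSd E m).comp (push (affIn σ) m) = (push (affIn σ) m).comp (sd (bary n) m) from
    LinearMap.congr_fun h c
  refine tuples_hom_ext fun v => ?_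
  simp only [LinearMap.comp_apply]
  rw [push_sx, affIn_app, sgSd_sx, affIn_comp, push_comp, push_sd (bary_aff v),
    push_mapTuples_fund]

lemma sgHtpy_push {n m : ℕ} (σ : C(Simp n, E)) (c : Chn (tuples (Simp n)) m) :
    sgHtpy E m (push (affIn σ) m c) = push (affIn σ) (m + 1) (htpy (bary n) m c) := by
  suffices h : (sgHtpy E m).comp (push (affIn σ) m) =
      (push (affIn σ) (m + 1)).comp (htpy (bary n) m) from LinearMap.congr_fun h c
  refine tuples_hom_ext fun v => ?_
  simp only [LinearMap.comp_apply]
  rw [push_sx, affIn_app, sgHtpy_sx, affIn_comp, push_comp, push_htpy (bary_aff v),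
    push_mapTuples_fund]

lemma bd_sgSd (n : ℕ) (c : Chn (sgObj E) (n + 1)) :
    bd (sgObj E) n (sgSd E (n + 1) c) = sgSd E n (bd (sgObj E) n c) := by
  suffices h : (bd (sgObj E) n).comp (sgSd E (n + 1)) = (sgSd E n).comp (bd (sgObj E) n) from
    LinearMap.congr_fun h c
  refine sg_hom_ext fun σ => ?_
  simp only [LinearMap.comp_apply]
  rw [sgSd_sx, ← push_bd, bd_sd, ← sgSd_push, push_bd, push_affIn_fund]

lemma bd_sgHtpy_zero (c : Chn (sgObj E) 0) :
    bd (sgObj E) 0 (sgHtpy E 0 c) = c - sgSd E 0 c := by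
  suffices h : (bd (sgObj E) 0).comp (sgHtpy E 0) = LinearMap.id - sgSd E 0 from
    LinearMap.congr_fun h c
  refine sg_hom_ext fun σ => ?_
  simp only [LinearMap.comp_apply, LinearMap.sub_apply, LinearMap.id_apply]
  rw [sgHtpy_sx, ← push_bd, bd_htpy_zero, map_sub, push_affIn_fund, sgSd_sx]

lemma bd_sgHtpy (n : ℕ) (c : Chn (sgObj E) (n + 1)) :
    bd (sgObj E) (n + 1) (sgHtpy E (n + 1) c) =
      c - sgSd E (n + 1) c - sgHtpy E n (bd (sgObj E) n c) := by
  suffices h : (bd (sgObj E) (n + 1)).comp (sgHtpy E (n + 1)) =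
      LinearMap.id - sgSd E (n + 1) - (sgHtpy E n).comp (bd (sgObj E) n) from
    LinearMap.congr_fun h c
  refine sg_hom_ext fun σ => ?_
  simp only [LinearMap.comp_apply, LinearMap.sub_apply, LinearMap.id_apply]
  rw [sgHtpy_sx, ← push_bd, bd_htpy, map_sub, map_sub, push_affIn_fund, sgSd_sx,
    ← sgHtpy_push, push_bd, push_affIn_fund]

end Subdiv
end

noncomputable section

open CategoryTheory Simplicial Opposite

namespace Subdiv

open Chn

/-- A linear map sends chains supported on `s` into `N` if it does so for simplices in `s`. -/
lemma map_mem_of_supported {α M : Type} [AddCommGroup M] [Module ℚ M] {s : Set α}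
    (f : (α →₀ ℚ) →ₗ[ℚ] M) (N : Submodule ℚ M)
    (h : ∀ a ∈ s, f (Finsupp.single a 1) ∈ N) {c : α →₀ ℚ}
    (hc : c ∈ Finsupp.supported ℚ ℚ s) : f c ∈ N := by
  rw [Finsupp.supported_eq_span_single] at hc
  have : Submodule.span ℚ ((fun i => Finsupp.single i (1 : ℚ)) '' s) ≤ N.comap f := by
    rw [Submodule.span_le]
    rintro _ ⟨a, ha, rfl⟩
    exact h a ha
  exact this hc

/-- Tuples in the hull of `v` with mutual distances at most `r`. -/
def fineIn {n m k : ℕ} (v : Fin (m + 1) → Simp n) (r : ℝ) : Set ((tuples (Simp n)) _⦋k⦌) :=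
  Set.ofPred fun w : Fin (k + 1) → Simp n =>
    (∀ C : Set (Fin (n + 1) → ℝ), Convex ℝ C → (∀ i, (v i).1 ∈ C) → ∀ j, (w j).1 ∈ C) ∧
      ∀ i j, dist (w i).1 (w j).1 ≤ r

lemma tup_mem_fineIn {n m k : ℕ} (v : Fin (m + 1) → Simp n) (r : ℝ) (w : Fin (k + 1) → Simp n) :
    tup w ∈ fineIn v r ↔
      (∀ C : Set (Fin (n + 1) → ℝ), Convex ℝ C → (∀ i, (v i).1 ∈ C) → ∀ j, (w j).1 ∈ C) ∧
      ∀ i j, dist (w i).1 (w j).1 ≤ r := Iff.rfl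

lemma dist_bary_le {n m : ℕ} (v : Fin (m + 1) → Simp n) (r : ℝ)
    (h : ∀ i j, dist (v i).1 (v j).1 ≤ r) (j : Fin (m + 1)) :
    dist (v j).1 (bary n m v).1 ≤ m / (m + 1) * r := by
  have hb : (bary n m v).1 = ∑ i, ((m + 1 : ℝ))⁻¹ • (v i).1 := by
    rw [bary, aff_val]
    refine Finset.sum_congr rfl fun i _ => ?_
    congr 1
    have := stdSimplex.barycenter_apply (𝕜 := ℝ) i
    rw [Fintype.card_fin, Nat.cast_succ] at this
    exact this
  have hm : (0 : ℝ) < m + 1 := by positivity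
  have e : (v j).1 - (bary n m v).1 =
      ∑ i ∈ Finset.univ.erase j, ((m + 1 : ℝ))⁻¹ • ((v j).1 - (v i).1) := by
    rw [Finset.sum_erase _ (by simp), hb]
    simp only [smul_sub, Finset.sum_sub_distrib, Finset.sum_const, Finset.card_univ,
      Fintype.card_fin]
    rw [← Nat.cast_smul_eq_nsmul ℝ, smul_smul]
    push_cast
    rw [mul_inv_cancel₀ hm.ne', one_smul]
  rw [dist_eq_norm, e]
  refine (norm_sum_le _ _).trans ?_
  refine (Finset.sum_le_card_nsmul _ _ ((m + 1 : ℝ)⁻¹ * r) fun i _ => ?_).trans ?_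
  · rw [norm_smul, Real.norm_of_nonneg (by positivity), ← dist_eq_norm]
    gcongr
    exact h j i
  · rw [Finset.card_erase_of_mem (Finset.mem_univ _), Finset.card_univ, Fintype.card_fin]
    simp
    rw [div_eq_mul_inv, mul_assoc]

lemma sd_mem_fineIn {n m : ℕ} (v : Fin (m + 1) → Simp n) (r : ℝ)
    (h : ∀ i j, dist (v i).1 (v j).1 ≤ r) :
    sd (bary n) m (sx _ (tup v)) ∈ Finsupp.supported ℚ ℚ (fineIn v (m / (m + 1) * r)) := by
  induction m with
  | zero =>
    rw [sd_zero]
    refine Finsupp.single_mem_supported _ _ ?_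
    rw [tup_mem_fineIn]
    refine ⟨fun C _ hC => hC, fun i j => ?_⟩
    rw [Subsingleton.elim (α := Fin 1) i j]
    simp
  | succ m ih =>
    have hr : 0 ≤ r := (dist_self (v 0).1).symm.trans_le (h 0 0)
    rw [sd_sx, bd_sx, map_sum, map_sum]
    refine Submodule.sum_mem _ fun i _ => ?_
    rw [map_zsmul, map_zsmul]
    refine zsmul_mem ?_ _
    rw [tuples_δ]
    refine map_mem_of_supported (cone _ _) _ ?_ (ih (v ∘ i.succAbove) fun _ _ => h _ _)
    intro (w : Fin (m + 1) → Simp n) hw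
    change cone _ _ (sx _ (tup w)) ∈ _
    rw [cone_sx]
    refine Finsupp.single_mem_supported _ _ ?_
    change tup w ∈ _ at hw
    rw [tup_mem_fineIn] at hw ⊢
    obtain ⟨hw1, hw2⟩ := hw
    have hw1' : ∀ C : Set (Fin (n + 1) → ℝ), Convex ℝ C → (∀ i, (v i).1 ∈ C) → ∀ j, (w j).1 ∈ C :=
      fun C hC hv => hw1 C hC fun _ => hv _
    have hbary : ∀ j, dist (w j).1 (bary n (m + 1) v).1 ≤
        ((m + 1 : ℕ) : ℝ) / ((m + 1 : ℕ) + 1) * r := by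
      intro j
      exact hw1' (Metric.closedBall _ _) (convex_closedBall _ _)
        (fun i => Metric.mem_closedBall.2 (dist_bary_le v r h i)) j
    constructor
    · intro C hC hv j
      refine Fin.cases ?_ (fun j => ?_) j
      · rw [Fin.cons_zero, bary, aff_val]
        exact hC.sum_mem (fun i _ => (stdSimplex.barycenter : Simp (m + 1)).2.1 i)
          (stdSimplex.barycenter : Simp (m + 1)).2.2 fun i _ => hv i
      · rw [Fin.cons_succ]
        exact hw1' C hC hv j
    · intro i j
      refine Fin.cases ?_ (fun i => ?_) i <;> refine Fin.cases ?_ (fun j => ?_) j <;>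
        simp only [Fin.cons_zero, Fin.cons_succ]
      · rw [dist_self]; positivity
      · rw [dist_comm]; exact hbary j
      · exact hbary i
      · refine (hw2 i j).trans ?_
        gcongr ?_ * r
        push_cast
        rw [div_le_div_iff₀ (by positivity) (by positivity)]
        nlinarith

/-- Tuples with mutual distances at most `r`. -/
def fine {n m : ℕ} (r : ℝ) : Set ((tuples (Simp n)) _⦋m⦌) :=
  Set.ofPred fun w : Fin (m + 1) → Simp n => ∀ i j, dist (w i).1 (w j).1 ≤ r

lemma sd_mem_fine {n m : ℕ} (r : ℝ) {c : Chn (tuples (Simp n)) m}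
    (hc : c ∈ Finsupp.supported ℚ ℚ (fine r)) :
    sd (bary n) m c ∈ Finsupp.supported ℚ ℚ (fine (m / (m + 1) * r)) := by
  refine map_mem_of_supported _ _ ?_ hc
  intro (v : Fin (m + 1) → Simp n) hv
  exact Finsupp.supported_mono (fun w hw => hw.2) (sd_mem_fineIn v r hv)

lemma sd_iterate_fund (n k : ℕ) :
    (sd (bary n) n)^[k] (fund n) ∈ Finsupp.supported ℚ ℚ (fine ((n / (n + 1) : ℝ) ^ k * 1)) := by
  induction k with
  | zero =>
    refine Finsupp.single_mem_supported _ _ ?_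
    intro i j
    rw [pow_zero, one_mul]
    exact (Metric.dist_le_diam_of_mem (bounded_stdSimplex (Fin (n + 1)))
      (Subtype.mem _) (Subtype.mem _)).trans diam_stdSimplex_le
  | succ k ih =>
    rw [Function.iterate_succ_apply', pow_succ', mul_assoc]
    exact sd_mem_fine _ ih

variable {E : Type} [TopologicalSpace E]

/-- The simplices lying in `U` or in `V`. -/
def smallSet (U V : Set E) (n : ℕ) : Set ((sgObj E) _⦋n⦌) :=
  Set.ofPred fun σ : C(Simp n, E) => (∀ x, σ x ∈ U) ∨ ∀ x, σ x ∈ V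

/-- The chains of simplices lying in `U` or in `V`. -/
def small (U V : Set E) (n : ℕ) : Submodule ℚ (Chn (sgObj E) n) :=
  Finsupp.supported ℚ ℚ (smallSet U V n)

lemma push_affIn_mem_small {U V : Set E} {n m : ℕ} {σ : C(Simp n, E)} (h : smp σ ∈ smallSet U V n)
    (c : Chn (tuples (Simp n)) m) : push (affIn σ) m c ∈ small U V m := by
  refine map_mem_of_supported (s := Set.univ) _ _ ?_ (by simp)
  intro (v : Fin (m + 1) → Simp n) _
  change push _ _ (sx _ (tup v)) ∈ _
  rw [push_sx, affIn_app]
  refine Finsupp.single_mem_supported _ _ ?_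
  exact h.imp (fun h x => h _) (fun h x => h _)

lemma sgSd_mem_small {U V : Set E} {n : ℕ} {c : Chn (sgObj E) n} (hc : c ∈ small U V n) :
    sgSd E n c ∈ small U V n := by
  refine map_mem_of_supported _ _ ?_ hc
  intro (σ : C(Simp n, E)) hσ
  change sgSd E n (sx _ (smp σ)) ∈ _
  rw [sgSd_sx]
  exact push_affIn_mem_small hσ _

lemma sgHtpy_mem_small {U V : Set E} {n : ℕ} {c : Chn (sgObj E) n} (hc : c ∈ small U V n) :
    sgHtpy E n c ∈ small U V (n + 1) := by
  refine map_mem_of_supported _ _ ?_ hc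
  intro (σ : C(Simp n, E)) hσ
  change sgHtpy E n (sx _ (smp σ)) ∈ _
  rw [sgHtpy_sx]
  exact push_affIn_mem_small hσ _

lemma sgSd_iterate_mem_small {U V : Set E} {n : ℕ} {c : Chn (sgObj E) n} (hc : c ∈ small U V n)
    (k : ℕ) : (sgSd E n)^[k] c ∈ small U V n := by
  induction k with
  | zero => exact hc
  | succ k ih => rw [Function.iterate_succ_apply']; exact sgSd_mem_small ih

lemma sgSd_iterate_push {n m : ℕ} (σ : C(Simp n, E)) (c : Chn (tuples (Simp n)) m) (k : ℕ) :
    (sgSd E m)^[k] (push (affIn σ) m c) = push (affIn σ) m ((sd (bary n) m)^[k] c) := by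
  induction k with
  | zero => rfl
  | succ k ih => rw [Function.iterate_succ_apply', ih, sgSd_push, Function.iterate_succ_apply']

lemma exists_sgSd_iterate_sx_mem {U V : Set E} (hU : IsOpen U) (hV : IsOpen V)
    (hUV : U ∪ V = Set.univ) {n : ℕ} (σ : C(Simp n, E)) :
    ∃ k, (sgSd E n)^[k] (sx (sgObj E) (smp σ)) ∈ small U V n := by
  obtain ⟨δ, hδ, h⟩ := lebesgue_number_lemma_of_metric (s := (Set.univ : Set (Simp n)))
    (c := fun b : Bool => σ ⁻¹' (if b then U else V)) isCompact_univ
    (fun b => by cases b <;> simp [hU, hV, IsOpen.preimage σ.continuous]) (by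
      intro x _
      have : σ x ∈ U ∪ V := hUV ▸ Set.mem_univ _
      rw [Set.mem_iUnion]
      rcases this with h | h
      · exact ⟨true, by simpa using h⟩
      · exact ⟨false, by simpa using h⟩)
  have hn : (n / (n + 1) : ℝ) < 1 := by rw [div_lt_one (by positivity)]; linarith
  obtain ⟨k, hk⟩ := exists_pow_lt_of_lt_one hδ hn
  refine ⟨k, ?_⟩
  rw [← push_affIn_fund, sgSd_iterate_push]
  refine map_mem_of_supported _ _ ?_ (sd_iterate_fund n k)
  intro (v : Fin (n + 1) → Simp n) hv
  change push _ _ (sx _ (tup v)) ∈ _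
  rw [push_sx, affIn_app]
  refine Finsupp.single_mem_supported _ _ ?_
  obtain ⟨b, hb⟩ := h (v 0) (Set.mem_univ _)
  have key : ∀ x, σ (aff v x) ∈ if b then U else V := by
    intro x
    refine hb ?_
    change (aff v x).1 ∈ Metric.ball (v 0).1 δ
    rw [aff_val]
    refine (convex_ball _ _).sum_mem (fun i _ => x.2.1 i) x.2.2 fun i _ => ?_
    exact (hv i 0).trans_lt (by rwa [mul_one])
  cases b
  · exact Or.inr key
  · exact Or.inl key

lemma exists_sgSd_iterate_mem {U V : Set E} (hU : IsOpen U) (hV : IsOpen V)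
    (hUV : U ∪ V = Set.univ) {n : ℕ} (c : Chn (sgObj E) n) :
    ∃ k, (sgSd E n)^[k] c ∈ small U V n := by
  have iter_add : ∀ (k : ℕ) (a b : Chn (sgObj E) n),
      (sgSd E n)^[k] (a + b) = (sgSd E n)^[k] a + (sgSd E n)^[k] b := fun k a b =>
    iterate_map_add (sgSd E n) k a b
  induction c using Finsupp.induction_linear with
  | zero => exact ⟨0, Submodule.zero_mem _⟩
  | add a b ha hb =>
    obtain ⟨k, hk⟩ := ha
    obtain ⟨l, hl⟩ := hb
    refine ⟨k + l, ?_⟩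
    rw [iter_add]
    refine Submodule.add_mem _ ?_ ?_
    · rw [add_comm, Function.iterate_add_apply]
      exact sgSd_iterate_mem_small hk l
    · rw [Function.iterate_add_apply]
      exact sgSd_iterate_mem_small hl k
  | single σ q =>
    obtain ⟨k, hk⟩ := exists_sgSd_iterate_sx_mem hU hV hUV (σ : C(Simp n, E))
    refine ⟨k, ?_⟩
    have : Finsupp.single σ q = q • sx (sgObj E) (smp σ) := by
      simp [sx, smp]
    rw [this, ← Module.End.pow_apply, map_smul, Module.End.pow_apply]
    exact Submodule.smul_mem _ _ hk

/-- A chain whose boundary is small is small up to a boundary. -/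
lemma exists_small_add_bd {U V : Set E} (hU : IsOpen U) (hV : IsOpen V)
    (hUV : U ∪ V = Set.univ) (n : ℕ) (c : Chn (sgObj E) (n + 1))
    (hc : bd (sgObj E) n c ∈ small U V n) :
    ∃ w, c - bd (sgObj E) (n + 1) w ∈ small U V (n + 1) := by
  obtain ⟨k, hk⟩ := exists_sgSd_iterate_mem hU hV hUV c
  induction k generalizing c with
  | zero => exact ⟨0, by simpa using hk⟩
  | succ k ih =>
    obtain ⟨w, hw⟩ := ih (sgSd E (n + 1) c) (by rw [bd_sgSd]; exact sgSd_mem_small hc)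
      (by simpa using hk)
    refine ⟨w + sgHtpy E (n + 1) c, ?_⟩
    rw [map_add, bd_sgHtpy]
    convert Submodule.add_mem _ hw (sgHtpy_mem_small hc) using 1
    abel

lemma exists_small_add_bd_zero {U V : Set E} (hU : IsOpen U) (hV : IsOpen V)
    (hUV : U ∪ V = Set.univ) (c : Chn (sgObj E) 0) :
    ∃ w, c - bd (sgObj E) 0 w ∈ small U V 0 := by
  obtain ⟨k, hk⟩ := exists_sgSd_iterate_mem hU hV hUV c
  induction k generalizing c with
  | zero => exact ⟨0, by simpa using hk⟩
  | succ k ih =>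
    obtain ⟨w, hw⟩ := ih (sgSd E 0 c) (by simpa using hk)
    refine ⟨w + sgHtpy E 0 c, ?_⟩
    rw [map_add, bd_sgHtpy_zero]
    convert hw using 1
    abel

end Subdiv
end

noncomputable section

open CategoryTheory Simplicial Opposite Limits

open Chn

lemma push_injective {S S' : SSet.{0}} (f : S ⟶ S') (n : ℕ)
    (hf : Function.Injective (f.app (op ⦋n⦌))) : Function.Injective (push f n) :=
  Finsupp.mapDomain_injective hf

/-- Exactness of a chain complex of `ℚ`-modules in positive degrees, in terms of elements. -/
lemma exactAt_succ (K : ChainComplex (ModuleCat.{0} ℚ) ℕ) (n : ℕ)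
    (h : ∀ x : K.X (n + 1), (K.d (n + 1) n).hom x = 0 →
      ∃ y : K.X (n + 2), (K.d (n + 2) (n + 1)).hom y = x) : K.ExactAt (n + 1) := by
  rw [K.exactAt_iff' (n + 2) (n + 1) n (by simp) (by simp), ShortComplex.moduleCat_exact_iff]
  exact h

/-- Exactness of a chain complex of `ℚ`-modules in degree zero, in terms of elements. -/
lemma exactAt_zero (K : ChainComplex (ModuleCat.{0} ℚ) ℕ)
    (h : ∀ x : K.X 0, ∃ y : K.X 1, (K.d 1 0).hom y = x) : K.ExactAt 0 := by
  rw [K.exactAt_iff' 1 0 0 (by simp) (by simp), ShortComplex.moduleCat_exact_iff]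
  exact fun x _ => h x

/-- A degreewise injective map of simplicial sets through which every relative cycle factors up to
a boundary is a homology isomorphism. -/
lemma isIso_ssHom_map {P Q : SSet.{0}} (f : P ⟶ Q)
    (inj : ∀ n, Function.Injective (f.app (op ⦋n⦌)))
    (h0 : ∀ c : Chn Q 0, ∃ w, c - bd Q 0 w ∈ LinearMap.range (push f 0))
    (hs : ∀ (n : ℕ) (c : Chn Q (n + 1)), bd Q n c ∈ LinearMap.range (push f n) →
      ∃ w, c - bd Q (n + 1) w ∈ LinearMap.range (push f (n + 1))) (j : ℕ) :
    IsIso ((ssHom j).map f) := by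
  set φ := ratChains.map f with hφ
  have : Mono φ := HomologicalComplex.mono_of_mono_f _ fun n =>
    (ModuleCat.mono_iff_injective _).2 (push_injective f n (inj n))
  let S := ShortComplex.mk φ (cokernel.π φ) (cokernel.condition φ)
  have hS : S.ShortExact :=
    { exact := ShortComplex.exact_cokernel φ
      mono_f := this
      epi_g := inferInstanceAs (Epi (cokernel.π φ)) }
  have hd := (HomologicalComplex.shortExact_iff_degreewise_shortExact S).1 hS
  have surj : ∀ n, Function.Surjective ((cokernel.π φ).f n).hom := fun n =>
    (hd n).moduleCat_surjective_g
  have ex : ∀ n (c : Chn Q n), ((cokernel.π φ).f n).hom c = 0 →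
      c ∈ LinearMap.range (push f n) := fun n c hc =>
    (ShortComplex.moduleCat_exact_iff _).1 (hd n).exact c hc
  have ex' : ∀ n (c : Chn Q n), c ∈ LinearMap.range (push f n) →
      ((cokernel.π φ).f n).hom c = 0 := by
    rintro n _ ⟨y, rfl⟩
    exact (S.map (HomologicalComplex.eval _ _ n)).moduleCat_zero_apply y
  have comm : ∀ n (c : Chn Q (n + 1)), ((cokernel.π φ).f n).hom (bd Q n c) =
      ((cokernel φ).d (n + 1) n).hom (((cokernel.π φ).f (n + 1)).hom c) := by
    intro n c
    rw [← ratChains_d]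
    exact (congrArg (fun f => f.hom c) ((cokernel.π φ).comm (n + 1) n)).symm
  have acyc : ∀ n, (cokernel φ).ExactAt n := by
    intro n
    cases n with
    | zero =>
      refine exactAt_zero _ fun x => ?_
      obtain ⟨c, rfl⟩ := surj 0 x
      obtain ⟨w, hw⟩ := h0 c
      refine ⟨((cokernel.π φ).f 1).hom w, ?_⟩
      have e := (((cokernel.π φ).f 0).hom.map_sub c (bd Q 0 w)).symm.trans (ex' 0 _ hw)
      exact (comm 0 w).symm.trans (sub_eq_zero.1 e).symm
    | succ n =>
      refine exactAt_succ _ n fun x hx => ?_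
      obtain ⟨c, rfl⟩ := surj (n + 1) x
      obtain ⟨w, hw⟩ := hs n c (ex _ _ ((comm n c).trans hx))
      refine ⟨((cokernel.π φ).f (n + 2)).hom w, ?_⟩
      have e := (((cokernel.π φ).f (n + 1)).hom.map_sub c (bd Q (n + 1) w)).symm.trans
        (ex' (n + 1) _ hw)
      exact (comm (n + 1) w).symm.trans (sub_eq_zero.1 e).symm
  have hz : ∀ n, IsZero ((cokernel φ).homology n) := fun n => (acyc n).isZero_homology
  change IsIso (HomologicalComplex.homologyMap φ j)
  have : Mono (HomologicalComplex.homologyMap φ j) :=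
    (hS.homology_exact₁ (j + 1) j (by simp)).mono_g ((hz _).eq_of_src _ _)
  have : Epi (HomologicalComplex.homologyMap φ j) :=
    (hS.homology_exact₂ j).epi_f ((hz _).eq_of_tgt _ _)
  exact isIso_of_mono_of_epi _

/-- Lifting of a pair of chains with the same image in a cartesian square. -/
lemma exists_lift_chains {A B C D : SSet.{0}} (a : A ⟶ B) (a' : A ⟶ C) (b : B ⟶ D) (c : C ⟶ D)
    (comm : a ≫ b = a' ≫ c) (n : ℕ) (hb : Function.Injective (b.app (op ⦋n⦌)))
    (hc : Function.Injective (c.app (op ⦋n⦌)))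
    (hp : ∀ x y, b.app (op ⦋n⦌) x = c.app (op ⦋n⦌) y →
      ∃ z, a.app (op ⦋n⦌) z = x ∧ a'.app (op ⦋n⦌) z = y)
    (β : Chn B n) (γ : Chn C n) (h : push b n β = push c n γ) :
    ∃ α, push a n α = β ∧ push a' n α = γ := by
  have h1 : ∃ α, push a n α = β := by
    have : β ∈ Finsupp.supported ℚ ℚ (Set.range (a.app (op ⦋n⦌))) := by
      rw [Finsupp.mem_supported]
      intro σ hσ
      rw [Finset.mem_coe, Finsupp.mem_support_iff] at hσ
      have h2 : push b n β (b.app (op ⦋n⦌) σ) = β σ := Finsupp.mapDomain_apply hb _ _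
      rw [h] at h2
      by_contra hcon
      apply hσ
      rw [← h2]
      refine Finsupp.mapDomain_of_notMem_range _ _ ?_
      rintro ⟨τ, hτ⟩
      obtain ⟨z, hz, -⟩ := hp σ τ hτ.symm
      exact hcon ⟨z, hz⟩
    rw [← Set.image_univ, ← Finsupp.lmapDomain_supported] at this
    obtain ⟨α, -, hα⟩ := this
    exact ⟨α, hα⟩
  obtain ⟨α, rfl⟩ := h1
  refine ⟨α, rfl, push_injective c n hc ?_⟩
  rw [← h, ← Subdiv.push_comp, ← Subdiv.push_comp, comm]

/-- A degreewise bicartesian square of injections of simplicial sets. -/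
structure SqS {A B C D : SSet.{0}} (a : A ⟶ B) (a' : A ⟶ C) (b : B ⟶ D) (c : C ⟶ D) : Prop where
  comm : a ≫ b = a' ≫ c
  inj_a : ∀ n, Function.Injective (a.app (op ⦋n⦌))
  inj_b : ∀ n, Function.Injective (b.app (op ⦋n⦌))
  inj_c : ∀ n, Function.Injective (c.app (op ⦋n⦌))
  cart : ∀ n x y, b.app (op ⦋n⦌) x = c.app (op ⦋n⦌) y →
      ∃ z, a.app (op ⦋n⦌) z = x ∧ a'.app (op ⦋n⦌) z = y
  cover : ∀ n d, (∃ x, b.app (op ⦋n⦌) x = d) ∨ ∃ y, c.app (op ⦋n⦌) y = d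

/-- The Mayer–Vietoris short complex of a square. -/
def mvComplex {A B C D : SSet.{0}} (a : A ⟶ B) (a' : A ⟶ C) (b : B ⟶ D) (c : C ⟶ D)
    (comm : a ≫ b = a' ≫ c) : ShortComplex (ChainComplex (ModuleCat.{0} ℚ) ℕ) :=
  ShortComplex.mk (biprod.lift (ratChains.map a) (ratChains.map a'))
    (biprod.desc (ratChains.map b) (-ratChains.map c)) (by
      rw [biprod.lift_desc, Preadditive.comp_neg, ← Functor.map_comp, ← Functor.map_comp, comm,
        add_neg_cancel])

lemma biprod_elt (K L : ChainComplex (ModuleCat.{0} ℚ) ℕ) (n : ℕ) (x : (K ⊞ L).X n) :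
    ((biprod.inl : K ⟶ K ⊞ L).f n).hom (((biprod.fst : K ⊞ L ⟶ K).f n).hom x) +
      ((biprod.inr : L ⟶ K ⊞ L).f n).hom (((biprod.snd : K ⊞ L ⟶ L).f n).hom x) = x :=
  congrArg (fun f : K ⊞ L ⟶ K ⊞ L => (f.f n).hom x) (biprod.total (X := K) (Y := L))

/-- Elementwise value of a composite in a fixed degree. -/
lemma comp_f_apply {K L M : ChainComplex (ModuleCat.{0} ℚ) ℕ} {f : K ⟶ L} {g : L ⟶ M} {h : K ⟶ M}
    (e : f ≫ g = h) (n : ℕ) (x : K.X n) : (g.f n).hom ((f.f n).hom x) = (h.f n).hom x :=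
  congrArg (fun f : K ⟶ M => (f.f n).hom x) e

lemma SqS.shortExact {A B C D : SSet.{0}} {a : A ⟶ B} {a' : A ⟶ C} {b : B ⟶ D} {c : C ⟶ D}
    (h : SqS a a' b c) : (mvComplex a a' b c h.comm).ShortExact := by
  refine HomologicalComplex.shortExact_of_degreewise_shortExact _ fun n => ?_
  refine ModuleCat.shortComplex_shortExact _ ?_ ?_ ?_
  · intro (x : (ratChains.obj B ⊞ ratChains.obj C).X n)
    constructor
    · intro hx
      set β := ((biprod.fst : ratChains.obj B ⊞ ratChains.obj C ⟶ _).f n).hom x with hβ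
      set γ := ((biprod.snd : ratChains.obj B ⊞ ratChains.obj C ⟶ _).f n).hom x with hγ
      have hx' : ((biprod.desc (ratChains.map b) (-ratChains.map c)).f n).hom x = 0 := hx
      have e := biprod_elt _ _ n x
      rw [← e, map_add, comp_f_apply (biprod.inl_desc _ _),
        comp_f_apply (biprod.inr_desc _ _)] at hx'
      have : push b n β = push c n γ := by
        rw [← sub_eq_zero, sub_eq_add_neg]
        exact hx'
      obtain ⟨(α : (ratChains.obj A).X n), h1, h2⟩ :=
        exists_lift_chains a a' b c h.comm n (h.inj_b n) (h.inj_c n)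
        (h.cart n) β γ this
      refine ⟨α, ?_⟩
      change ((biprod.lift (ratChains.map a) (ratChains.map a')).f n).hom α = x
      rw [← e, ← biprod_elt _ _ n (((biprod.lift (ratChains.map a) (ratChains.map a')).f n).hom α),
        comp_f_apply (biprod.lift_fst _ _), comp_f_apply (biprod.lift_snd _ _)]
      congr 2
    · rintro ⟨y, rfl⟩
      exact ((mvComplex a a' b c h.comm).map (HomologicalComplex.eval _ _ n)).moduleCat_zero_apply y
  · intro (x : (ratChains.obj A).X n) (y : (ratChains.obj A).X n) hxy
    refine push_injective a n (h.inj_a n) ?_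
    have := congrArg ((biprod.fst : ratChains.obj B ⊞ ratChains.obj C ⟶ _).f n).hom hxy
    change ((biprod.fst : ratChains.obj B ⊞ ratChains.obj C ⟶ _).f n).hom
      (((biprod.lift (ratChains.map a) (ratChains.map a')).f n).hom x) =
      ((biprod.fst : ratChains.obj B ⊞ ratChains.obj C ⟶ _).f n).hom
      (((biprod.lift (ratChains.map a) (ratChains.map a')).f n).hom y) at this
    rw [comp_f_apply (biprod.lift_fst _ _), comp_f_apply (biprod.lift_fst _ _)] at this
    exact this
  · have : ∀ d : Chn D n, d ∈ LinearMap.range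
        ((biprod.desc (ratChains.map b) (-ratChains.map c)).f n).hom := by
      intro d
      refine Subdiv.map_mem_of_supported (s := Set.univ) LinearMap.id _ ?_ (c := d) (by simp)
      intro σ _
      rcases h.cover n σ with ⟨x, hx⟩ | ⟨y, hy⟩
      · refine ⟨((biprod.inl : ratChains.obj B ⟶ ratChains.obj B ⊞ ratChains.obj C).f n).hom
          (sx B x), ?_⟩
        refine (comp_f_apply (biprod.inl_desc _ _) n _).trans ?_
        exact (push_sx b n x).trans (by rw [hx]; rfl)
      · refine ⟨((biprod.inr : ratChains.obj C ⟶ ratChains.obj B ⊞ ratChains.obj C).f n).hom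
          (-sx C y), ?_⟩
        refine (comp_f_apply (biprod.inr_desc _ _) n _).trans ?_
        change -push c n (-sx C y) = _
        rw [map_neg, neg_neg, push_sx, hy]
        rfl
    intro d
    exact this d
end

noncomputable section

open CategoryTheory Simplicial Opposite Limits

open Chn

/-- The linear map on homology induced by a chain map. -/
def hK {K L : ChainComplex (ModuleCat.{0} ℚ) ℕ} (j : ℕ) (f : K ⟶ L) :
    K.homology j →ₗ[ℚ] L.homology j := (HomologicalComplex.homologyMap f j).hom

section
variable {K L M : ChainComplex (ModuleCat.{0} ℚ) ℕ}

lemma hK_comp {f : K ⟶ L} {g : L ⟶ M} {h : K ⟶ M} (e : f ≫ g = h) (j : ℕ) (x : K.homology j) :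
    hK j g (hK j f x) = hK j h x := by
  subst e
  exact (congrArg (fun f => f.hom x) (HomologicalComplex.homologyMap_comp f g j)).symm

lemma hK_id (j : ℕ) (x : K.homology j) : hK j (𝟙 K) x = x :=
  congrArg (fun f => f.hom x) (HomologicalComplex.homologyMap_id K j)

lemma hK_zero (j : ℕ) (x : K.homology j) : hK j (0 : K ⟶ L) x = 0 :=
  congrArg (fun f => f.hom x) (HomologicalComplex.homologyMap_zero K L j)

lemma hK_neg (j : ℕ) (f : K ⟶ L) (x : K.homology j) : hK j (-f) x = -hK j f x :=
  congrArg (fun f => f.hom x) (HomologicalComplex.homologyMap_neg f j)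

lemma hK_add (j : ℕ) (f g : K ⟶ L) (x : K.homology j) : hK j (f + g) x = hK j f x + hK j g x :=
  congrArg (fun f => f.hom x) (HomologicalComplex.homologyMap_add f g j)

lemma hK_biprod (j : ℕ) (x : (K ⊞ L).homology j) :
    hK j (biprod.inl : K ⟶ K ⊞ L) (hK j biprod.fst x) +
      hK j (biprod.inr : L ⟶ K ⊞ L) (hK j biprod.snd x) = x := by
  rw [hK_comp rfl, hK_comp rfl, ← hK_add, biprod.total, hK_id]
end

namespace SqS

variable {A B C D : SSet.{0}} {a : A ⟶ B} {a' : A ⟶ C} {b : B ⟶ D} {c : C ⟶ D}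
  (h : SqS a a' b c)

/-- The connecting map of the Mayer–Vietoris sequence. -/
def δ (j : ℕ) : (ratChains.obj D).homology (j + 1) →ₗ[ℚ] (ratChains.obj A).homology j :=
  (h.shortExact.δ (j + 1) j (by simp)).hom

lemma exists_of_eq (h : SqS a a' b c) (j : ℕ) (x : (ratChains.obj B).homology j)
    (y : (ratChains.obj C).homology j)
    (e : hK j (ratChains.map b) x = hK j (ratChains.map c) y) :
    ∃ z, hK j (ratChains.map a) z = x ∧ hK j (ratChains.map a') z = y := by
  let u := hK j (biprod.inl : _ ⟶ ratChains.obj B ⊞ ratChains.obj C) x +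
    hK j (biprod.inr : _ ⟶ ratChains.obj B ⊞ ratChains.obj C) y
  have hu : hK j (biprod.desc (ratChains.map b) (-ratChains.map c)) u = 0 := by
    rw [map_add, hK_comp (biprod.inl_desc _ _), hK_comp (biprod.inr_desc _ _), hK_neg, e,
      add_neg_cancel]
  obtain ⟨(z : (ratChains.obj A).homology j), hz⟩ :=
    (ShortComplex.moduleCat_exact_iff _).1 (h.shortExact.homology_exact₂ j) u hu
  have hz' : hK j (biprod.lift (ratChains.map a) (ratChains.map a')) z = u := hz
  refine ⟨z, ?_, ?_⟩
  · have := congrArg (hK j biprod.fst) hz'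
    rw [hK_comp (biprod.lift_fst _ _), map_add, hK_comp biprod.inl_fst, hK_comp biprod.inr_fst,
      hK_id, hK_zero, add_zero] at this
    exact this
  · have := congrArg (hK j biprod.snd) hz'
    rw [hK_comp (biprod.lift_snd _ _), map_add, hK_comp biprod.inl_snd, hK_comp biprod.inr_snd,
      hK_id, hK_zero, zero_add] at this
    exact this

lemma eq_add_of_desc (j : ℕ) (u : (ratChains.obj B ⊞ ratChains.obj C).homology j) :
    ∃ x y, hK j (biprod.desc (ratChains.map b) (-ratChains.map c)) u =
      hK j (ratChains.map b) x + hK j (ratChains.map c) y := by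
  refine ⟨hK j biprod.fst u, -hK j biprod.snd u, ?_⟩
  conv_lhs => rw [← hK_biprod j u]
  rw [map_add, hK_comp (biprod.inl_desc _ _), hK_comp (biprod.inr_desc _ _), hK_neg, map_neg]

lemma exists_of_δ_eq_zero (j : ℕ) (w : (ratChains.obj D).homology (j + 1)) (hw : h.δ j w = 0) :
    ∃ x y, w = hK _ (ratChains.map b) x + hK _ (ratChains.map c) y := by
  obtain ⟨u, hu⟩ := (ShortComplex.moduleCat_exact_iff _).1
    (h.shortExact.homology_exact₃ (j + 1) j (by simp)) w hw
  obtain ⟨x, y, e⟩ := eq_add_of_desc (b := b) (c := c) _ u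
  exact ⟨x, y, hu.symm.trans e⟩

lemma exists_zero (h : SqS a a' b c) (w : (ratChains.obj D).homology 0) :
    ∃ x y, w = hK 0 (ratChains.map b) x + hK 0 (ratChains.map c) y := by
  have := h.shortExact.epi_g
  have := HomologicalComplex.epi_homologyMap_of_epi_of_not_rel
    (mvComplex a a' b c h.comm).g 0 (by simp)
  obtain ⟨u, hu⟩ := (ModuleCat.epi_iff_surjective _).1 this w
  obtain ⟨x, y, e⟩ := eq_add_of_desc (b := b) (c := c) _ u
  exact ⟨x, y, hu.symm.trans e⟩

lemma δ_map (j : ℕ) (x : (ratChains.obj B).homology (j + 1)) :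
    h.δ j (hK _ (ratChains.map b) x) = 0 := by
  have e := congrArg (fun f => f.hom (hK (j + 1) biprod.inl x))
    (h.shortExact.comp_δ (j + 1) j (by simp))
  have e2 : h.δ j (hK (j + 1) (biprod.desc (ratChains.map b) (-ratChains.map c))
    (hK (j + 1) biprod.inl x)) = 0 := e
  rwa [hK_comp (biprod.inl_desc _ _)] at e2

lemma map_δ (j : ℕ) (w : (ratChains.obj D).homology (j + 1)) :
    hK j (ratChains.map a) (h.δ j w) = 0 ∧ hK j (ratChains.map a') (h.δ j w) = 0 := by
  have e := congrArg (fun f => f.hom w) (h.shortExact.δ_comp (j + 1) j (by simp))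
  have e2 : hK j (biprod.lift (ratChains.map a) (ratChains.map a')) (h.δ j w) = 0 := e
  constructor
  · have := congrArg (hK j biprod.fst) e2
    rwa [hK_comp (biprod.lift_fst _ _), map_zero] at this
  · have := congrArg (hK j biprod.snd) e2
    rwa [hK_comp (biprod.lift_snd _ _), map_zero] at this

lemma exists_δ_eq (j : ℕ) (z : (ratChains.obj A).homology j)
    (h1 : hK j (ratChains.map a) z = 0) (h2 : hK j (ratChains.map a') z = 0) :
    ∃ w, h.δ j w = z := by
  refine (ShortComplex.moduleCat_exact_iff _).1
    (h.shortExact.homology_exact₁ (j + 1) j (by simp)) z ?_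
  change hK j (biprod.lift (ratChains.map a) (ratChains.map a')) z = 0
  rw [← hK_biprod j (hK j _ z), hK_comp (biprod.lift_fst _ _), hK_comp (biprod.lift_snd _ _),
    h1, h2, map_zero, map_zero, add_zero]

lemma δ_nat {A₂ B₂ C₂ D₂ : SSet.{0}} {a₂ : A₂ ⟶ B₂} {a₂' : A₂ ⟶ C₂} {b₂ : B₂ ⟶ D₂}
    {c₂ : C₂ ⟶ D₂} (h₂ : SqS a₂ a₂' b₂ c₂) (fA : A ⟶ A₂) (fB : B ⟶ B₂) (fC : C ⟶ C₂) (fD : D ⟶ D₂)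
    (ea : a ≫ fB = fA ≫ a₂) (ea' : a' ≫ fC = fA ≫ a₂') (eb : b ≫ fD = fB ≫ b₂)
    (ec : c ≫ fD = fC ≫ c₂) (j : ℕ) (w : (ratChains.obj D).homology (j + 1)) :
    hK j (ratChains.map fA) (h.δ j w) = h₂.δ j (hK _ (ratChains.map fD) w) := by
  let φ : mvComplex a a' b c h.comm ⟶ mvComplex a₂ a₂' b₂ c₂ h₂.comm :=
    { τ₁ := ratChains.map fA
      τ₂ := biprod.map (ratChains.map fB) (ratChains.map fC)
      τ₃ := ratChains.map fD
      comm₁₂ := by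
        change ratChains.map fA ≫ biprod.lift (ratChains.map a₂) (ratChains.map a₂') =
          biprod.lift (ratChains.map a) (ratChains.map a') ≫
            biprod.map (ratChains.map fB) (ratChains.map fC)
        apply biprod.hom_ext
        · simp [← Functor.map_comp, ea]
        · simp [← Functor.map_comp, ea']
      comm₂₃ := by
        change biprod.map (ratChains.map fB) (ratChains.map fC) ≫
          biprod.desc (ratChains.map b₂) (-ratChains.map c₂) =
          biprod.desc (ratChains.map b) (-ratChains.map c) ≫ ratChains.map fD
        apply biprod.hom_ext'
        · simp [← Functor.map_comp, eb]
        · simp [← Functor.map_comp, ec] }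
  exact congrArg (fun f => f.hom w) (HomologicalComplex.HomologySequence.δ_naturality φ
    h.shortExact h₂.shortExact (j + 1) j (by simp))

end SqS
end

noncomputable section

open CategoryTheory Simplicial Opposite Limits

open Chn

section
variable {A B C E : Type} [TopologicalSpace A] [TopologicalSpace B] [TopologicalSpace C]
  [TopologicalSpace E]

/-- The singular simplices of `E` that factor through `b` or through `c`. -/
def smObj (b : C(B, E)) (c : C(C, E)) : SSet.{0} where
  obj n := {σ : C(Simp n.unop.len, E) // (∃ τ, b.comp τ = σ) ∨ ∃ τ, c.comp τ = σ}
  map f := TypeCat.ofHom fun σ => ⟨σ.1.comp (simpMap f.unop.toOrderHom), σ.2.imp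
    (fun ⟨τ, h⟩ => ⟨τ.comp (simpMap f.unop.toOrderHom), by rw [← h]; rfl⟩)
    (fun ⟨τ, h⟩ => ⟨τ.comp (simpMap f.unop.toOrderHom), by rw [← h]; rfl⟩)⟩
  map_id n := by
    refine ConcreteCategory.hom_ext _ _ fun σ => Subtype.ext ?_
    exact (congrArg σ.1.comp (simpMap_id _)).trans (ContinuousMap.comp_id σ.1)
  map_comp f g := by
    refine ConcreteCategory.hom_ext _ _ fun σ => Subtype.ext ?_
    exact congrArg σ.1.comp (simpMap_comp f.unop.toOrderHom g.unop.toOrderHom)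

/-- The inclusion of the simplices factoring through `b` or `c`. -/
def smIncl (b : C(B, E)) (c : C(C, E)) : smObj b c ⟶ Sg.obj (TopCat.of E) where
  app n := TypeCat.ofHom fun σ => σ.1

/-- The simplices factoring through `b`. -/
def smLeft (b : C(B, E)) (c : C(C, E)) : Sg.obj (TopCat.of B) ⟶ smObj b c where
  app n := TypeCat.ofHom fun σ => ⟨b.comp σ, Or.inl ⟨σ, rfl⟩⟩

/-- The simplices factoring through `c`. -/
def smRight (b : C(B, E)) (c : C(C, E)) : Sg.obj (TopCat.of C) ⟶ smObj b c where
  app n := TypeCat.ofHom fun σ => ⟨c.comp σ, Or.inr ⟨σ, rfl⟩⟩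

/-- A square of spaces exhibiting `E` as the union of two open subspaces `B`, `C` with
intersection `A`. -/
structure MVSq (a : C(A, B)) (a' : C(A, C)) (b : C(B, E)) (c : C(C, E)) : Prop where
  comm : b.comp a = c.comp a'
  emb_a : Topology.IsEmbedding a
  open_b : Topology.IsOpenEmbedding b
  open_c : Topology.IsOpenEmbedding c
  cart : ∀ x y, b x = c y → ∃ z, a z = x ∧ a' z = y
  cover : Set.range b ∪ Set.range c = Set.univ

/-- A continuous map into the range of an embedding lifts. -/
lemma exists_lift_embedding {X : Type} [TopologicalSpace X] {b : C(B, E)}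
    (hb : Topology.IsEmbedding b) (σ : C(X, E)) (h : ∀ x, σ x ∈ Set.range b) :
    ∃ τ : C(X, B), b.comp τ = σ := by
  choose f hf using h
  refine ⟨⟨f, hb.continuous_iff.2 ?_⟩, ContinuousMap.ext hf⟩
  convert σ.continuous using 1
  exact funext hf

lemma MVSq.sqS {a : C(A, B)} {a' : C(A, C)} {b : C(B, E)} {c : C(C, E)} (h : MVSq a a' b c) :
    SqS (Sg.map (TopCat.ofHom a)) (Sg.map (TopCat.ofHom a')) (smLeft b c) (smRight b c) where
  comm := by
    ext n σ
    exact Subtype.ext (congrArg (fun f : C(A, E) => f.comp σ) h.comm)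
  inj_a n σ τ e := by
    refine ContinuousMap.ext fun x => h.emb_a.injective ?_
    exact congrArg (fun f : C(Simp n, B) => f x) e
  inj_b n σ τ e := by
    refine ContinuousMap.ext fun x => h.open_b.injective ?_
    exact congrArg (fun f : C(Simp n, E) => f x) (congrArg Subtype.val e)
  inj_c n σ τ e := by
    refine ContinuousMap.ext fun x => h.open_c.injective ?_
    exact congrArg (fun f : C(Simp n, E) => f x) (congrArg Subtype.val e)
  cart n := by
    intro (σ : C(Simp n, B)) (τ : C(Simp n, C)) e
    have e' : ∀ x, b (σ x) = c (τ x) := fun x =>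
      congrArg (fun f : C(Simp n, E) => f x) (congrArg Subtype.val e)
    obtain ⟨ρ, hρ⟩ := exists_lift_embedding h.emb_a σ fun x =>
      (h.cart _ _ (e' x)).imp fun _ => And.left
    refine ⟨ρ, hρ, ContinuousMap.ext fun x => h.open_c.injective ?_⟩
    refine Eq.trans ?_ (e' x)
    rw [← hρ]
    exact (congrArg (fun f : C(A, E) => f (ρ x)) h.comm).symm
  cover n := by
    rintro ⟨σ, hσ⟩
    exact hσ.imp (fun ⟨τ, e⟩ => ⟨τ, Subtype.ext e⟩) (fun ⟨τ, e⟩ => ⟨τ, Subtype.ext e⟩)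

lemma mem_range_push_smIncl {b : C(B, E)} {c : C(C, E)} (hb : Topology.IsEmbedding b)
    (hc : Topology.IsEmbedding c) (n : ℕ) :
    LinearMap.range (push (smIncl b c) n) = Subdiv.small (Set.range b) (Set.range c) n := by
  have : Set.range ((smIncl b c).app (op ⦋n⦌)) =
      Subdiv.smallSet (Set.range b) (Set.range c) n := by
    refine Set.ext fun (σ : C(Simp n, E)) => ⟨?_, ?_⟩
    · rintro ⟨⟨σ, hσ⟩, rfl⟩
      rcases hσ with ⟨τ, rfl⟩ | ⟨τ, rfl⟩
      · exact Or.inl fun x => ⟨τ x, rfl⟩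
      · exact Or.inr fun x => ⟨τ x, rfl⟩
    · intro hσ
      exact ⟨⟨σ, hσ.imp (exists_lift_embedding hb σ) (exists_lift_embedding hc σ)⟩, rfl⟩
  unfold Subdiv.small
  rw [← this, ← Set.image_univ]
  have e := Finsupp.lmapDomain_supported ℚ ℚ ((smIncl b c).app (op ⦋n⦌)) Set.univ
  rw [Finsupp.supported_univ, Submodule.map_top] at e
  exact e

lemma MVSq.isIso_smIncl {a : C(A, B)} {a' : C(A, C)} {b : C(B, E)} {c : C(C, E)}
    (h : MVSq a a' b c) (j : ℕ) : IsIso ((ssHom j).map (smIncl b c)) := by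
  have hr := mem_range_push_smIncl h.open_b.isEmbedding h.open_c.isEmbedding
  refine isIso_ssHom_map _ (fun n σ τ e => Subtype.ext e) ?_ ?_ j
  · intro w
    rw [hr]
    exact Subdiv.exists_small_add_bd_zero h.open_b.isOpen_range h.open_c.isOpen_range h.cover w
  · intro n w
    rw [hr, hr]
    exact Subdiv.exists_small_add_bd h.open_b.isOpen_range h.open_c.isOpen_range h.cover n w

namespace MVSq
variable {a : C(A, B)} {a' : C(A, C)} {b : C(B, E)} {c : C(C, E)} (h : MVSq a a' b c)

/-- The homology of `E` is computed by small simplices. -/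
def smEquiv (j : ℕ) : (ratChains.obj (smObj b c)).homology j ≃ₗ[ℚ] Hm j E :=
  LinearEquiv.ofBijective (hK j (ratChains.map (smIncl b c)))
    ((ConcreteCategory.isIso_iff_bijective _).1 (h.isIso_smIncl j))

lemma smEquiv_apply (j : ℕ) (x : (ratChains.obj (smObj b c)).homology j) :
    h.smEquiv j x = hK j (ratChains.map (smIncl b c)) x := rfl

lemma hm_eq_hK {X Y : Type} [TopologicalSpace X] [TopologicalSpace Y] (j : ℕ) (f : C(X, Y))
    (x : Hm j X) : hm j f x = hK j (ratChains.map (Sg.map (TopCat.ofHom f))) x := rfl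

lemma smEquiv_left (j : ℕ) (x : Hm j B) :
    h.smEquiv j (hK j (ratChains.map (smLeft b c)) x) = hm j b x := by
  rw [smEquiv_apply, hm_eq_hK]
  exact hK_comp (ratChains.map_comp _ _).symm j x

lemma smEquiv_right (j : ℕ) (x : Hm j C) :
    h.smEquiv j (hK j (ratChains.map (smRight b c)) x) = hm j c x := by
  rw [smEquiv_apply, hm_eq_hK]
  exact hK_comp (ratChains.map_comp _ _).symm j x

/-- The connecting map of the Mayer–Vietoris sequence. -/
def δ (j : ℕ) : Hm (j + 1) E →ₗ[ℚ] Hm j A :=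
  (h.sqS.δ j).comp ((h.smEquiv (j + 1)).symm : Hm (j + 1) E →ₗ[ℚ] _)

lemma δ_smEquiv (j : ℕ) (w) : h.δ j (h.smEquiv (j + 1) w) = h.sqS.δ j w := by
  exact congrArg (h.sqS.δ j) ((h.smEquiv (j + 1)).symm_apply_apply w)

lemma exists_of_eq (h : MVSq a a' b c) (j : ℕ) (x : Hm j B) (y : Hm j C) (e : hm j b x = hm j c y) :
    ∃ z, hm j a z = x ∧ hm j a' z = y := by
  refine h.sqS.exists_of_eq j x y ((h.smEquiv j).injective ?_)
  rw [smEquiv_left, smEquiv_right, e]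

lemma exists_of_δ_eq_zero (j : ℕ) (w : Hm (j + 1) E) (hw : h.δ j w = 0) :
    ∃ x y, w = hm _ b x + hm _ c y := by
  obtain ⟨x, y, e⟩ := h.sqS.exists_of_δ_eq_zero j _ hw
  refine ⟨x, y, (h.smEquiv _).symm.injective (e.trans ?_)⟩
  rw [LinearEquiv.eq_symm_apply, map_add, smEquiv_left, smEquiv_right]

lemma exists_zero (h : MVSq a a' b c) (w : Hm 0 E) : ∃ x y, w = hm 0 b x + hm 0 c y := by
  obtain ⟨x, y, e⟩ := h.sqS.exists_zero ((h.smEquiv 0).symm w)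
  refine ⟨x, y, (h.smEquiv _).symm.injective (e.trans ?_)⟩
  rw [LinearEquiv.eq_symm_apply, map_add, smEquiv_left, smEquiv_right]

lemma δ_map (j : ℕ) (x : Hm (j + 1) B) : h.δ j (hm _ b x) = 0 := by
  rw [← h.smEquiv_left, δ_smEquiv]
  exact h.sqS.δ_map j x

lemma map_δ (j : ℕ) (w : Hm (j + 1) E) :
    hm j a (h.δ j w) = 0 ∧ hm j a' (h.δ j w) = 0 :=
  h.sqS.map_δ j _

lemma exists_δ_eq (j : ℕ) (z : Hm j A) (h1 : hm j a z = 0) (h2 : hm j a' z = 0) :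
    ∃ w, h.δ j w = z := by
  obtain ⟨w, hw⟩ := h.sqS.exists_δ_eq j z h1 h2
  exact ⟨h.smEquiv _ w, (h.δ_smEquiv j w).trans hw⟩

lemma δ_nat {A₂ B₂ C₂ E₂ : Type} [TopologicalSpace A₂] [TopologicalSpace B₂] [TopologicalSpace C₂]
    [TopologicalSpace E₂] {a₂ : C(A₂, B₂)} {a₂' : C(A₂, C₂)} {b₂ : C(B₂, E₂)}
    {c₂ : C(C₂, E₂)} (h₂ : MVSq a₂ a₂' b₂ c₂) (fA : C(A, A₂)) (fB : C(B, B₂)) (fC : C(C, C₂))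
    (fE : C(E, E₂)) (ea : fB.comp a = a₂.comp fA) (ea' : fC.comp a' = a₂'.comp fA)
    (eb : fE.comp b = b₂.comp fB) (ec : fE.comp c = c₂.comp fC) (j : ℕ) (w : Hm (j + 1) E) :
    hm j fA (h.δ j w) = h₂.δ j (hm _ fE w) := by
  obtain ⟨w, rfl⟩ := (h.smEquiv _).surjective w
  let fD : smObj b c ⟶ smObj b₂ c₂ :=
    { app := fun n => TypeCat.ofHom fun σ => ⟨fE.comp σ.1, σ.2.imp
        (fun ⟨τ, e⟩ => ⟨fB.comp τ, by
          rw [← e, ← ContinuousMap.comp_assoc, ← ContinuousMap.comp_assoc, eb]⟩)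
        (fun ⟨τ, e⟩ => ⟨fC.comp τ, by
          rw [← e, ← ContinuousMap.comp_assoc, ← ContinuousMap.comp_assoc, ec]⟩)⟩ }
  have key : hm _ fE (h.smEquiv (j + 1) w) = h₂.smEquiv (j + 1) (hK _ (ratChains.map fD) w) := by
    have e : smIncl b c ≫ Sg.map (TopCat.ofHom fE) = fD ≫ smIncl b₂ c₂ := rfl
    exact (hK_comp (ratChains.map_comp _ _).symm _ w).trans
      ((congrArg (fun f => hK _ (ratChains.map f) w) e).trans
        (hK_comp (ratChains.map_comp _ _).symm _ w).symm)
  rw [key, δ_smEquiv, δ_smEquiv]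
  refine h.sqS.δ_nat h₂.sqS (Sg.map (TopCat.ofHom fA)) (Sg.map (TopCat.ofHom fB))
    (Sg.map (TopCat.ofHom fC)) fD ?_ ?_ ?_ ?_ j w
  · rw [← Functor.map_comp, ← Functor.map_comp, ← TopCat.ofHom_comp, ← TopCat.ofHom_comp, ea]
  · rw [← Functor.map_comp, ← Functor.map_comp, ← TopCat.ofHom_comp, ← TopCat.ofHom_comp, ea']
  · ext n σ
    exact Subtype.ext (congrArg (fun f : C(B, E₂) => f.comp σ) eb)
  · ext n σ
    exact Subtype.ext (congrArg (fun f : C(C, E₂) => f.comp σ) ec)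

end MVSq
end
end

noncomputable section

open CategoryTheory Simplicial Opposite Limits

open Chn

section
variable {X Y : Type} [TopologicalSpace X] [TopologicalSpace Y]

/-- Homotopy inverses induce inverse maps on homology. -/
def hmEquiv (j : ℕ) (f : C(X, Y)) (g : C(Y, X))
    (hfg : (f.comp g).Homotopic (ContinuousMap.id Y))
    (hgf : (g.comp f).Homotopic (ContinuousMap.id X)) : Hm j X ≃ₗ[ℚ] Hm j Y :=
  { hm j f with
    invFun := hm j g
    left_inv := fun x => by
      change hm j g (hm j f x) = x
      rw [← hm_comp, hm_eq_of_homotopic j hgf, hm_id]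
    right_inv := fun x => by
      change hm j f (hm j g x) = x
      rw [← hm_comp, hm_eq_of_homotopic j hfg, hm_id] }

lemma hm_injective_of_homotopic_id (j : ℕ) {f : C(X, Y)} {g : C(Y, X)}
    (h : (g.comp f).Homotopic (ContinuousMap.id X)) : Function.Injective (hm j f) := by
  intro x y e
  have := congrArg (hm j g) e
  rwa [← hm_comp, ← hm_comp, hm_eq_of_homotopic j h, hm_id, hm_id] at this

lemma hm_of_isEmpty [IsEmpty X] (j : ℕ) (x : Hm j X) : x = 0 := by
  have hz : ∀ n (y : (ratChains.obj (Sg.obj (TopCat.of X))).X n), y = 0 := fun n y =>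
    Finsupp.ext fun σ : C(Simp n, X) => isEmptyElim (σ (stdSimplex.vertex 0))
  have : (ratChains.obj (Sg.obj (TopCat.of X))).ExactAt j := by
    cases j with
    | zero => exact exactAt_zero _ fun y => ⟨0, (map_zero _).trans (hz _ y).symm⟩
    | succ n => exact exactAt_succ _ n fun y _ => ⟨0, (map_zero _).trans (hz _ y).symm⟩
  have := ModuleCat.subsingleton_of_isZero this.isZero_homology
  exact Subsingleton.elim _ _

lemma sum_neg_one_pow_fin (n : ℕ) :
    (∑ i : Fin (n + 2), (-1 : ℚ) ^ (i : ℕ)) = if Even n then 0 else 1 := by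
  rw [Fin.sum_univ_eq_sum_range (fun i => (-1 : ℚ) ^ i) (n + 2)]
  have h2 : ∀ m, ∑ i ∈ Finset.range (2 * m), (-1 : ℚ) ^ i = 0 := by
    intro m
    induction m with
    | zero => simp
    | succ m ih => rw [mul_add, mul_one, Finset.sum_range_succ, Finset.sum_range_succ, ih]; ring
  by_cases h : Even n
  · obtain ⟨m, rfl⟩ := h
    rw [if_pos ⟨m, rfl⟩, show m + m + 2 = 2 * (m + 1) by ring, h2]
  · obtain ⟨m, rfl⟩ := Nat.not_even_iff_odd.1 h
    rw [if_neg h, show 2 * m + 1 + 2 = 2 * (m + 1) + 1 by ring, Finset.sum_range_succ, h2]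
    simp [pow_mul]

lemma bd_of_unique [Unique X] (n : ℕ) (q : ℚ) :
    bd (sgObj X) n (q • sx _ (Subdiv.smp (default : C(Simp (n + 1), X)))) =
      (if Even n then 0 else q) • sx _ (Subdiv.smp (default : C(Simp n, X))) := by
  rw [map_smul, bd_sx]
  have : ∀ i : Fin (n + 2), (sgObj X).δ i (Subdiv.smp (default : C(Simp (n + 1), X))) =
      Subdiv.smp (default : C(Simp n, X)) :=
    fun i => ContinuousMap.ext fun x => Subsingleton.elim _ _
  simp_rw [this]
  rw [← Finset.sum_smul, ← Int.cast_smul_eq_zsmul ℚ, smul_smul]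
  push_cast
  rw [sum_neg_one_pow_fin]
  split_ifs <;> simp

lemma chn_of_unique [Unique X] (n : ℕ) (c : Chn (sgObj X) n) :
    c = c (Subdiv.smp (default : C(Simp n, X))) • sx _ (Subdiv.smp (default : C(Simp n, X))) := by
  refine Finsupp.ext fun (σ : C(Simp n, X)) => ?_
  obtain rfl : default = σ := ContinuousMap.ext fun x => Subsingleton.elim _ _
  change c (Subdiv.smp default) = c (Subdiv.smp default) *
    (Finsupp.single (Subdiv.smp (default : C(Simp n, X))) (1 : ℚ)) (Subdiv.smp default)
  rw [Finsupp.single_eq_same, mul_one]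

lemma hm_succ_of_unique [Unique X] (j : ℕ) (x : Hm (j + 1) X) : x = 0 := by
  have key : ∀ y : Chn (sgObj X) (j + 1), bd _ j y = 0 → ∃ z, bd _ (j + 1) z = y := by
    intro y hy
    have e := chn_of_unique (j + 1) y
    by_cases h : Even j
    · refine ⟨y (Subdiv.smp (default : C(Simp (j + 1), X))) •
        sx _ (Subdiv.smp (default : C(Simp (j + 2), X))), ?_⟩
      refine (bd_of_unique (j + 1) _).trans ?_
      rw [if_neg (by simpa [Nat.even_add_one] using h)]
      exact e.symm
    · refine ⟨0, (map_zero _).trans ?_⟩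
      have e2 := (congrArg (bd _ j) e).symm.trans hy
      rw [bd_of_unique, if_neg h] at e2
      have e3 := DFunLike.congr_fun e2 (Subdiv.smp (default : C(Simp j, X)))
      have e4 : y (Subdiv.smp (default : C(Simp (j + 1), X))) = 0 := by
        simpa [sx] using e3
      rw [e4, zero_smul] at e
      exact e.symm
  have : (ratChains.obj (sgObj X)).ExactAt (j + 1) := by
    refine exactAt_succ _ j fun y hy => ?_
    rw [ratChains_d] at *
    exact key y hy
  have : Subsingleton (Hm (j + 1) X) := ModuleCat.subsingleton_of_isZero this.isZero_homology
  exact Subsingleton.elim _ _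

/-- The zeroth homology of a point. -/
lemma hmZeroOfUnique [Unique X] : Nonempty (Hm 0 X ≃ₗ[ℚ] ℚ) := by
  let K := ratChains.obj (sgObj X)
  have hd : K.d 1 0 = 0 := by
    refine ModuleCat.hom_ext ((ratChains_d _ 0).trans (LinearMap.ext fun y => ?_))
    rw [chn_of_unique 1 y]
    exact (bd_of_unique 0 _).trans (by rw [if_pos (by simp), zero_smul]; rfl)
  have h1 := K.isIso_homologyπ 1 0 (by simp) hd
  have h2 := K.isIso_iCycles 0 0 (by simp) (K.shape _ _ (by simp))
  have e : K.homology 0 ≅ K.X 0 := (asIso (K.homologyπ 0)).symm ≪≫ asIso (K.iCycles 0)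
  have : Subsingleton ((sgObj X) _⦋0⦌) :=
    ⟨fun σ τ => ContinuousMap.ext fun x => Subsingleton.elim _ _⟩
  exact ⟨e.toLinearEquiv.trans (Finsupp.uniqueLinearEquiv ℚ ℚ (Subdiv.smp default))⟩

end
end

noncomputable section

section
variable {A B C E : Type} [TopologicalSpace A] [TopologicalSpace B] [TopologicalSpace C]
  [TopologicalSpace E] {a : C(A, B)} {a' : C(A, C)} {b : C(B, E)} {c : C(C, E)}

namespace MVSq

/-- If the Mayer–Vietoris sequence splits on the left, it splits on the right. -/
lemma exists_add_of_injective (h : MVSq a a' b c)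
    (inj : ∀ j z, hm j a z = 0 → hm j a' z = 0 → z = 0) (j : ℕ) (w : Hm j E) :
    ∃ x y, w = hm j b x + hm j c y := by
  cases j with
  | zero => exact h.exists_zero w
  | succ j => exact h.exists_of_δ_eq_zero j w (inj j _ (h.map_δ j w).1 (h.map_δ j w).2)

lemma hm_comm (h : MVSq a a' b c) (j : ℕ) (z : Hm j A) :
    hm j b (hm j a z) = hm j c (hm j a' z) := by
  rw [← hm_comp, ← hm_comp, h.comm]

lemma exact_split (h : MVSq a a' b c) (j : ℕ) :
    Function.Exact ((hm j a).prod (hm j a')) ((hm j b).coprod (-hm j c)) := by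
  rintro ⟨x, y⟩
  constructor
  · intro e
    have e' : hm j b x = hm j c y := by
      simpa [add_neg_eq_zero] using e
    obtain ⟨z, rfl, rfl⟩ := h.exists_of_eq j x y e'
    exact ⟨z, rfl⟩
  · rintro ⟨z, hz⟩
    rw [← hz]
    simp [h.hm_comm]

lemma surjective_split (h : MVSq a a' b c)
    (inj : ∀ j z, hm j a z = 0 → hm j a' z = 0 → z = 0) (j : ℕ) :
    Function.Surjective ((hm j b).coprod (-hm j c)) := by
  intro w
  obtain ⟨x, y, rfl⟩ := h.exists_add_of_injective inj j w
  exact ⟨(x, -y), by simp⟩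

lemma finite_union (h : MVSq a a' b c)
    (inj : ∀ j z, hm j a z = 0 → hm j a' z = 0 → z = 0) (j : ℕ)
    [Module.Finite ℚ (Hm j B)] [Module.Finite ℚ (Hm j C)] : Module.Finite ℚ (Hm j E) :=
  Module.Finite.of_surjective _ (h.surjective_split inj j)

lemma finite_left (h : MVSq a a' b c)
    (inj : ∀ j z, hm j a z = 0 → hm j a' z = 0 → z = 0) (j : ℕ)
    [Module.Finite ℚ (Hm j A)] [Module.Finite ℚ (Hm j E)] : Module.Finite ℚ (Hm j B) := by
  have := Module.Finite.of_exact (h.exact_split j) (h.surjective_split inj j)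
  exact Module.Finite.of_surjective (LinearMap.fst ℚ (Hm j B) (Hm j C)) LinearMap.fst_surjective

lemma finrank_add (h : MVSq a a' b c)
    (inj : ∀ j z, hm j a z = 0 → hm j a' z = 0 → z = 0) (j : ℕ)
    [Module.Finite ℚ (Hm j B)] [Module.Finite ℚ (Hm j C)] :
    Module.finrank ℚ (Hm j B) + Module.finrank ℚ (Hm j C) =
      Module.finrank ℚ (Hm j A) + Module.finrank ℚ (Hm j E) := by
  have h1 := LinearMap.finrank_range_add_finrank_ker ((hm j b).coprod (-hm j c))
  rw [LinearMap.range_eq_top.2 (h.surjective_split inj j), finrank_top,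
    (LinearMap.exact_iff.1 (h.exact_split j)), LinearMap.finrank_range_of_inj, Module.finrank_prod]
    at h1
  · omega
  · refine (injective_iff_map_eq_zero _).2 fun z hz => ?_
    exact inj j z (congrArg Prod.fst hz) (congrArg Prod.snd hz)

end MVSq

/-- Two open subsets form a Mayer–Vietoris square. -/
lemma MVSq.ofSets {T : Type} [TopologicalSpace T] {S S₁ S₂ S₁₂ : Set T} (h₁ : IsOpen S₁)
    (h₂ : IsOpen S₂) (hS : S = S₁ ∪ S₂) (hi : S₁₂ = S₁ ∩ S₂) (i₁ : S₁₂ ⊆ S₁) (i₂ : S₁₂ ⊆ S₂)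
    (j₁ : S₁ ⊆ S) (j₂ : S₂ ⊆ S) :
    MVSq (ContinuousMap.inclusion i₁) (ContinuousMap.inclusion i₂) (ContinuousMap.inclusion j₁)
      (ContinuousMap.inclusion j₂) where
  comm := rfl
  emb_a := .inclusion i₁
  open_b := .inclusion j₁ (h₁.preimage continuous_subtype_val)
  open_c := .inclusion j₂ (h₂.preimage continuous_subtype_val)
  cart := by
    rintro ⟨x, hx⟩ ⟨y, hy⟩ e
    obtain rfl : x = y := congrArg Subtype.val e
    exact ⟨⟨x, hi ▸ ⟨hx, hy⟩⟩, rfl, rfl⟩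
  cover := by
    refine Set.eq_univ_of_forall fun ⟨x, hx⟩ => ?_
    rw [hS] at hx
    rcases hx with hx | hx
    · exact Or.inl ⟨⟨x, hx⟩, rfl⟩
    · exact Or.inr ⟨⟨x, hx⟩, rfl⟩

/-- The product of a Mayer–Vietoris square with a space. -/
lemma MVSq.prod (h : MVSq a a' b c) (X : Type) [TopologicalSpace X] :
    MVSq ((ContinuousMap.id X).prodMap a) ((ContinuousMap.id X).prodMap a')
      ((ContinuousMap.id X).prodMap b) ((ContinuousMap.id X).prodMap c) where
  comm := ContinuousMap.ext fun x => Prod.ext rfl (congrArg (fun f : C(A, E) => f x.2) h.comm)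
  emb_a := .prodMap .id h.emb_a
  open_b := .prodMap .id h.open_b
  open_c := .prodMap .id h.open_c
  cart := by
    rintro ⟨x, s⟩ ⟨y, t⟩ e
    obtain rfl : x = y := congrArg Prod.fst e
    obtain ⟨z, rfl, rfl⟩ := h.cart s t (congrArg Prod.snd e)
    exact ⟨(x, z), rfl, rfl⟩
  cover := by
    refine Set.eq_univ_of_forall fun ⟨x, e⟩ => ?_
    have : e ∈ Set.range b ∪ Set.range c := by rw [h.cover]; trivial
    rcases this with ⟨y, rfl⟩ | ⟨y, rfl⟩
    · exact Or.inl ⟨(x, y), rfl⟩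
    · exact Or.inr ⟨(x, y), rfl⟩
end

section
variable (X : Type) [TopologicalSpace X]

/-- The section of a projection given by a point. -/
def sec {T : Type} [TopologicalSpace T] (t : T) : C(X, X × T) :=
  (ContinuousMap.id X).prodMk (ContinuousMap.const X t)

/-- The projection of a product. -/
abbrev prX (T : Type) [TopologicalSpace T] : C(X × T, X) := ContinuousMap.fst

variable {X}

lemma hm_prX_sec {T : Type} [TopologicalSpace T] (t : T) (j : ℕ) (x : Hm j X) :
    hm j (prX X T) (hm j (sec X t) x) = x := by
  rw [← hm_comp]
  exact hm_id j x

lemma hm_prX_injective {S : Set ℂ} {s : ℂ} (hs : s ∈ S) (hS : StarConvex ℝ s S) (j : ℕ) :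
    Function.Injective (hm j (prX X S)) := by
  refine hm_injective_of_homotopic_id (g := sec X ⟨s, hs⟩) j ?_
  refine ⟨⟨⟨fun p => (p.2.1, ⟨(1 - (p.1 : ℝ)) • s + (p.1 : ℝ) • (p.2.2 : ℂ), ?_⟩), ?_⟩, ?_, ?_⟩⟩
  · exact hS p.2.2.2 (by linarith [p.1.2.2]) p.1.2.1 (by ring)
  · fun_prop
  · rintro ⟨x, t⟩
    refine Prod.ext rfl (Subtype.ext ?_)
    simp [sec]
  · rintro ⟨x, t⟩
    refine Prod.ext rfl (Subtype.ext ?_)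
    simp

lemma hm_sec_prX {S : Set ℂ} {s : ℂ} (hs : s ∈ S) (hS : StarConvex ℝ s S) (t : S) (j : ℕ)
    (z : Hm j (X × S)) : hm j (sec X t) (hm j (prX X S) z) = z :=
  hm_prX_injective hs hS j (hm_prX_sec t j _)

/-- The homology of a product with a star-shaped set. -/
def prXEquiv {S : Set ℂ} {s : ℂ} (hs : s ∈ S) (hS : StarConvex ℝ s S) (j : ℕ) :
    Hm j (X × S) ≃ₗ[ℚ] Hm j X :=
  LinearEquiv.ofBijective (hm j (prX X S))
    ⟨hm_prX_injective hs hS j, fun x => ⟨hm j (sec X ⟨s, hs⟩) x, hm_prX_sec _ j x⟩⟩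
end
end

noncomputable section

/-- The nonzero complex numbers. -/
abbrev Cs : Set ℂ := {0}ᶜ

/-- The nonreal complex numbers. -/
abbrev nonreal : Set ℂ := {z | z.im ≠ 0}

/-- The opposite slit plane. -/
abbrev negSlit : Set ℂ := {z | -z ∈ Complex.slitPlane}

/-- The upper half plane. -/
abbrev upper : Set ℂ := {z | 0 < z.im}

/-- The lower half plane. -/
abbrev lower : Set ℂ := {z | z.im < 0}

lemma starConvex_negSlit : StarConvex ℝ (-1 : ℂ) negSlit := by
  intro z hz s t hs ht hst
  have := Complex.starConvex_one_slitPlane hz hs ht hst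
  change -(s • (-1 : ℂ) + t • z) ∈ Complex.slitPlane
  convert this using 1
  simp [add_comm]

lemma starConvex_upper : StarConvex ℝ Complex.I upper :=
  (convex_halfSpace_im_gt 0).starConvex (by simp)

lemma starConvex_lower : StarConvex ℝ (-Complex.I) lower :=
  (convex_halfSpace_im_lt 0).starConvex (by simp)

lemma neg_I_mem_lower : -Complex.I ∈ lower := by simp

lemma I_mem_upper : Complex.I ∈ upper := by simp

lemma neg_one_mem_negSlit : (-1 : ℂ) ∈ negSlit := by simp [negSlit]

lemma I_mem_negSlit : Complex.I ∈ negSlit := by simp [negSlit, Complex.mem_slitPlane_iff]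

lemma I_mem_slitPlane : Complex.I ∈ Complex.slitPlane := by simp [Complex.mem_slitPlane_iff]

lemma nonreal_subset_slit : nonreal ⊆ Complex.slitPlane := fun _ hz => Or.inr hz

lemma nonreal_subset_negSlit : nonreal ⊆ negSlit := fun z hz => Or.inr (by simpa using hz)

lemma slit_subset : Complex.slitPlane ⊆ Cs := fun _ hz => Complex.slitPlane_ne_zero hz

lemma negSlit_subset : negSlit ⊆ Cs := fun z hz e => by
  have := Complex.slitPlane_ne_zero hz
  simp_all

lemma upper_subset : upper ⊆ nonreal := fun _ hz => ne_of_gt hz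

lemma lower_subset : lower ⊆ nonreal := fun _ hz => ne_of_lt hz

lemma mvCs : MVSq (ContinuousMap.inclusion nonreal_subset_slit)
    (ContinuousMap.inclusion nonreal_subset_negSlit) (ContinuousMap.inclusion slit_subset)
    (ContinuousMap.inclusion negSlit_subset) := by
  refine MVSq.ofSets Complex.isOpen_slitPlane
    (Complex.isOpen_slitPlane.preimage continuous_neg) ?_ ?_ _ _ _ _
  · ext z
    simp only [Set.mem_compl_iff, Set.mem_singleton_iff, Set.mem_union,
      Complex.mem_slitPlane_iff, Complex.neg_re, Complex.neg_im, Complex.ext_iff, Complex.zero_re,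
      Complex.zero_im, neg_ne_zero, Set.mem_preimage]
    constructor
    · intro h
      by_contra! hc
      exact h ⟨by linarith [hc.1.1, hc.2.1], hc.1.2⟩
    · rintro h ⟨h1, h2⟩
      simp [h1, h2] at h
  · ext z
    simp only [Set.mem_inter_iff, Set.mem_ofPred_eq, Set.mem_preimage,
      Complex.mem_slitPlane_iff, Complex.neg_re, Complex.neg_im, neg_ne_zero]
    constructor
    · exact fun h => ⟨Or.inr h, Or.inr h⟩
    · rintro ⟨h1 | h1, h2 | h2⟩ <;> first | assumption | linarith

lemma mvNonreal : MVSq (ContinuousMap.inclusion (Set.empty_subset upper))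
    (ContinuousMap.inclusion (Set.empty_subset lower)) (ContinuousMap.inclusion upper_subset)
    (ContinuousMap.inclusion lower_subset) := by
  refine MVSq.ofSets (isOpen_lt continuous_const Complex.continuous_im)
    (isOpen_lt Complex.continuous_im continuous_const) ?_ ?_ _ _ _ _
  · ext z
    simp only [Set.mem_ofPred_eq, Set.mem_union]
    exact ne_iff_lt_or_gt.trans or_comm
  · ext z
    simp only [Set.mem_ofPred_eq, Set.mem_inter_iff, Set.mem_empty_iff_false, false_iff, not_and,
      not_lt]
    exact le_of_lt

section
variable (X : Type) [TopologicalSpace X]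

lemma hm_prod_empty (j : ℕ) (z : Hm j (X × (∅ : Set ℂ))) : z = 0 := hm_of_isEmpty j z

lemma finite_nonreal (j : ℕ) [Module.Finite ℚ (Hm j X)] : Module.Finite ℚ (Hm j (X × nonreal)) := by
  have := Module.Finite.equiv (prXEquiv (X := X) I_mem_upper starConvex_upper j).symm
  have := Module.Finite.equiv (prXEquiv (X := X) neg_I_mem_lower starConvex_lower j).symm
  exact (mvNonreal.prod X).finite_union (fun j z _ _ => hm_prod_empty X j z) j

lemma finrank_nonreal (j : ℕ) [Module.Finite ℚ (Hm j X)] :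
    Module.finrank ℚ (Hm j (X × nonreal)) =
      Module.finrank ℚ (Hm j X) + Module.finrank ℚ (Hm j X) := by
  have := Module.Finite.equiv (prXEquiv (X := X) I_mem_upper starConvex_upper j).symm
  have := Module.Finite.equiv (prXEquiv (X := X) neg_I_mem_lower starConvex_lower j).symm
  have h := (mvNonreal.prod X).finrank_add (fun j z _ _ => hm_prod_empty X j z) j
  rw [(prXEquiv (X := X) I_mem_upper starConvex_upper j).finrank_eq,
    (prXEquiv (X := X) neg_I_mem_lower starConvex_lower j).finrank_eq] at h
  have := finite_nonreal X j
  have h0 : Module.finrank ℚ (Hm j (X × (∅ : Set ℂ))) = 0 := by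
    have : Subsingleton (Hm j (X × (∅ : Set ℂ))) :=
      ⟨fun x y => (hm_prod_empty X j x).trans (hm_prod_empty X j y).symm⟩
    exact Module.finrank_zero_of_subsingleton
  rw [h0, zero_add] at h
  exact h.symm

/-- The connecting map for `X × ℂ*`. -/
def δCs (j : ℕ) : Hm (j + 1) (X × Cs) →ₗ[ℚ] Hm j (X × nonreal) := (mvCs.prod X).δ j

/-- The section of `X × ℂ* → X`. -/
def secCs : C(X, X × Cs) := sec X ⟨Complex.I, by simp⟩

variable {X}

lemma hm_left_add_right {j : ℕ} {w : Hm j (X × Cs)} {x : Hm j (X × Complex.slitPlane)}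
    {y : Hm j (X × negSlit)}
    (h : w = hm j ((ContinuousMap.id X).prodMap (ContinuousMap.inclusion slit_subset)) x +
      hm j ((ContinuousMap.id X).prodMap (ContinuousMap.inclusion negSlit_subset)) y) :
    ∃ u, w = hm j (secCs X) u := by
  refine ⟨hm j (prX X _) x + hm j (prX X _) y, ?_⟩
  rw [h, map_add]
  congr 1
  · conv_lhs => rw [← hm_sec_prX Complex.one_mem_slitPlane Complex.starConvex_one_slitPlane
      ⟨_, I_mem_slitPlane⟩ j x, ← hm_comp]
    rfl
  · conv_lhs => rw [← hm_sec_prX neg_one_mem_negSlit starConvex_negSlit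
      ⟨_, I_mem_negSlit⟩ j y, ← hm_comp]
    rfl

lemma exists_secCs_of_δ (j : ℕ) (w : Hm (j + 1) (X × Cs)) (h : δCs X j w = 0) :
    ∃ u, w = hm _ (secCs X) u := by
  obtain ⟨x, y, e⟩ := (mvCs.prod X).exists_of_δ_eq_zero j w h
  exact hm_left_add_right e

lemma exists_secCs_zero (w : Hm 0 (X × Cs)) : ∃ u, w = hm _ (secCs X) u := by
  obtain ⟨x, y, e⟩ := (mvCs.prod X).exists_zero w
  exact hm_left_add_right e

lemma δCs_secCs (j : ℕ) (x : Hm (j + 1) X) : δCs X j (hm _ (secCs X) x) = 0 := by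
  have : secCs X = ((ContinuousMap.id X).prodMap (ContinuousMap.inclusion slit_subset)).comp
    (sec X ⟨_, I_mem_slitPlane⟩) := rfl
  rw [this, hm_comp]
  exact (mvCs.prod X).δ_map j _

lemma range_δCs (j : ℕ) : LinearMap.range (δCs X j) = LinearMap.ker (hm j (prX X nonreal)) := by
  have e1 : prX X nonreal = (prX X Complex.slitPlane).comp
    ((ContinuousMap.id X).prodMap (ContinuousMap.inclusion nonreal_subset_slit)) := rfl
  have e2 : prX X nonreal = (prX X negSlit).comp
    ((ContinuousMap.id X).prodMap (ContinuousMap.inclusion nonreal_subset_negSlit)) := rfl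
  ext z
  rw [LinearMap.mem_ker]
  constructor
  · rintro ⟨w, rfl⟩
    rw [e1, hm_comp]
    exact (congrArg _ ((mvCs.prod X).map_δ j w).1).trans (map_zero _)
  · intro h
    refine (mvCs.prod X).exists_δ_eq j z ?_ ?_
    · rw [e1, hm_comp] at h
      exact hm_prX_injective Complex.one_mem_slitPlane Complex.starConvex_one_slitPlane j
        (h.trans (map_zero _).symm)
    · rw [e2, hm_comp] at h
      exact hm_prX_injective neg_one_mem_negSlit starConvex_negSlit j (h.trans (map_zero _).symm)

lemma ker_δCs (j : ℕ) : LinearMap.ker (δCs X j) = LinearMap.range (hm (j + 1) (secCs X)) := by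
  ext w
  constructor
  · intro h
    obtain ⟨u, rfl⟩ := exists_secCs_of_δ j w h
    exact ⟨u, rfl⟩
  · rintro ⟨u, rfl⟩
    exact δCs_secCs j u

lemma secCs_injective (j : ℕ) : Function.Injective (hm j (secCs X)) :=
  Function.LeftInverse.injective (g := hm j (prX X Cs)) (hm_prX_sec _ j)

variable (X)

/-- The zeroth homology of `X × ℂ*`. -/
def hmZeroCs : Hm 0 X ≃ₗ[ℚ] Hm 0 (X × Cs) :=
  LinearEquiv.ofBijective (hm 0 (secCs X))
    ⟨secCs_injective 0, fun w => (exists_secCs_zero w).imp fun _ => Eq.symm⟩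

lemma finite_prod_Cs_succ (j : ℕ) [Module.Finite ℚ (Hm j X)] [Module.Finite ℚ (Hm (j + 1) X)] :
    Module.Finite ℚ (Hm (j + 1) (X × Cs)) := by
  have := finite_nonreal X j
  refine Module.Finite.of_exact (f := hm (j + 1) (secCs X)) (g := (δCs X j).rangeRestrict) ?_
    (LinearMap.surjective_rangeRestrict _)
  rw [LinearMap.exact_iff, LinearMap.ker_rangeRestrict, ker_δCs]

lemma finrank_prod_Cs_succ (j : ℕ) [Module.Finite ℚ (Hm j X)] [Module.Finite ℚ (Hm (j + 1) X)] :
    Module.finrank ℚ (Hm (j + 1) (X × Cs)) =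
      Module.finrank ℚ (Hm (j + 1) X) + Module.finrank ℚ (Hm j X) := by
  have := finite_nonreal X j
  have := finite_prod_Cs_succ X j
  have h1 := LinearMap.finrank_range_add_finrank_ker (δCs X j)
  have h2 := LinearMap.finrank_range_add_finrank_ker (hm j (prX X nonreal))
  rw [range_δCs, ker_δCs, LinearMap.finrank_range_of_inj (secCs_injective _)] at h1
  rw [LinearMap.range_eq_top.2, finrank_top, finrank_nonreal] at h2
  · omega
  · exact fun x => ⟨hm j (sec X ⟨Complex.I, by simp⟩) x, hm_prX_sec _ j x⟩

variable {X} {Y : Type} [TopologicalSpace Y]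

lemma prod_star_injective {S : Set ℂ} {s : ℂ} (hs : s ∈ S) (hS : StarConvex ℝ s S) {f : C(X, Y)}
    {j : ℕ} (hf : Function.Injective (hm j f)) :
    Function.Injective (hm j (f.prodMap (ContinuousMap.id S))) := by
  intro x y e
  have := congrArg (hm j (prX Y S)) e
  rw [← hm_comp, ← hm_comp] at this
  have e2 : (prX Y S).comp (f.prodMap (ContinuousMap.id S)) = f.comp (prX X S) := rfl
  rw [e2, hm_comp, hm_comp] at this
  exact hm_prX_injective hs hS j (hf this)

lemma prod_nonreal_injective {f : C(X, Y)} {j : ℕ} (hf : Function.Injective (hm j f)) :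
    Function.Injective (hm j (f.prodMap (ContinuousMap.id nonreal))) := by
  refine (injective_iff_map_eq_zero _).2 fun z hz => ?_
  obtain ⟨x, y, rfl⟩ := (mvNonreal.prod X).exists_add_of_injective
    (fun j z _ _ => hm_prod_empty X j z) j z
  rw [map_add, ← hm_comp, ← hm_comp] at hz
  have hz2 : hm j ((ContinuousMap.id Y).prodMap (ContinuousMap.inclusion upper_subset))
      (hm j (f.prodMap (ContinuousMap.id upper)) x) =
      hm j ((ContinuousMap.id Y).prodMap (ContinuousMap.inclusion lower_subset))
      (-hm j (f.prodMap (ContinuousMap.id lower)) y) := by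
    rw [map_neg, ← hm_comp, ← hm_comp]
    exact eq_neg_of_add_eq_zero_left hz
  obtain ⟨w, h1, h2⟩ := (mvNonreal.prod Y).exists_of_eq j _ _ hz2
  rw [hm_prod_empty Y j w, map_zero] at h1 h2
  have hx : x = 0 := prod_star_injective I_mem_upper starConvex_upper hf
    (h1.symm.trans (map_zero _).symm)
  have hy : y = 0 := prod_star_injective neg_I_mem_lower starConvex_lower hf
    ((neg_eq_zero.1 h2.symm).trans (map_zero _).symm)
  rw [hx, hy, map_zero, map_zero, add_zero]

/-- A map injective on homology stays so after taking the product with `ℂ*`. -/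
lemma prod_Cs_injective {f : C(X, Y)} (hf : ∀ j, Function.Injective (hm j f)) (j : ℕ) :
    Function.Injective (hm j (f.prodMap (ContinuousMap.id Cs))) := by
  have e : ((prX Y Cs).comp (f.prodMap (ContinuousMap.id Cs))).comp (secCs X) = f := rfl
  have key : ∀ j u, hm j (f.prodMap (ContinuousMap.id Cs)) (hm j (secCs X) u) = 0 → u = 0 := by
    intro j u hu
    have := congrArg (hm j (prX Y Cs)) hu
    rw [← hm_comp, ← hm_comp, e, map_zero] at this
    exact hf j (this.trans (map_zero _).symm)
  refine (injective_iff_map_eq_zero _).2 fun z hz => ?_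
  cases j with
  | zero =>
    obtain ⟨u, rfl⟩ := exists_secCs_zero z
    rw [key 0 u hz, map_zero]
  | succ j =>
    have hδ : hm j (f.prodMap (ContinuousMap.id nonreal)) (δCs X j z) =
        δCs Y j (hm _ (f.prodMap (ContinuousMap.id Cs)) z) :=
      (mvCs.prod X).δ_nat (mvCs.prod Y) (f.prodMap (ContinuousMap.id nonreal))
        (f.prodMap (ContinuousMap.id _)) (f.prodMap (ContinuousMap.id _))
        (f.prodMap (ContinuousMap.id Cs)) rfl rfl rfl rfl j z
    rw [hz, map_zero] at hδ
    obtain ⟨u, rfl⟩ := exists_secCs_of_δ j z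
      (prod_nonreal_injective (hf j) (hδ.trans (map_zero _).symm))
    rw [key _ u hz, map_zero]
end
end

noncomputable section

section
variable {κ V : Type} [NormedAddCommGroup V] [NormedSpace ℂ V]

/-- The complement of the zero sets of the affine functions `f i + c i` for `i ∈ s`. -/
def cpl (f : κ → V →L[ℂ] ℂ) (c : κ → ℂ) (s : Finset κ) : Set V :=
  {x | ∀ i ∈ s, f i x + c i ≠ 0}

/-- The map of the complement to a torus given by the affine functions `f i + c i`. -/
def toTorus (f : κ → V →L[ℂ] ℂ) (c : κ → ℂ) (s : Finset κ) : C(cpl f c s, κ → Cs) where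
  toFun x i := if h : i ∈ s then ⟨f i x + c i, x.2 i h⟩ else ⟨1, one_ne_zero⟩
  continuous_toFun := by
    refine continuous_pi fun i => ?_
    by_cases h : i ∈ s
    · simp only [h, dite_true]
      fun_prop
    · simp only [h, dite_false]
      fun_prop

/-- The complement has Poincaré polynomial `P` and embeds into a torus on homology. -/
def HasBetti (f : κ → V →L[ℂ] ℂ) (c : κ → ℂ) (s : Finset κ) (P : Polynomial ℤ) : Prop :=
  ∀ j, Module.Finite ℚ (Hm j (cpl f c s)) ∧
    (Module.finrank ℚ (Hm j (cpl f c s)) : ℤ) = P.coeff j ∧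
    Function.Injective (hm j (toTorus f c s))

lemma isOpen_cpl (f : κ → V →L[ℂ] ℂ) (c : κ → ℂ) (s : Finset κ) : IsOpen (cpl f c s) := by
  have : cpl f c s = ⋂ i ∈ s, {x | f i x + c i ≠ 0} := by
    ext x
    simp [cpl]
  rw [this]
  exact isOpen_biInter_finset fun i _ => isOpen_ne_fun (by fun_prop) continuous_const

/-- Setting a coordinate of the torus to one. -/
def resetCoord (H : κ) : C(κ → Cs, κ → Cs) where
  toFun t := Function.update t H ⟨1, one_ne_zero⟩
  continuous_toFun := continuous_id.update H continuous_const

/-- Splitting a coordinate off the torus. -/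
def splitCoord (H : κ) : C(κ → Cs, (κ → Cs) × Cs) :=
  (resetCoord H).prodMk ⟨fun t => t H, continuous_apply H⟩

lemma cpl_insert_subset (f : κ → V →L[ℂ] ℂ) (c : κ → ℂ) (s : Finset κ) (H : κ) :
    cpl f c (insert H s) ⊆ cpl f c s := fun _ hx i hi => hx i (Finset.mem_insert_of_mem hi)

lemma resetCoord_toTorus (f : κ → V →L[ℂ] ℂ) (c : κ → ℂ) {s : Finset κ} {H : κ} (hH : H ∉ s) :
    (resetCoord H).comp (toTorus f c (insert H s)) =
      (toTorus f c s).comp (ContinuousMap.inclusion (cpl_insert_subset f c s H)) := by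
  ext x i
  by_cases hi : i = H
  · subst hi
    simp [resetCoord, toTorus, hH]
  · simp [resetCoord, toTorus, hi, ContinuousMap.inclusion]

/-- Deleting a function without zeros does not change the complement. -/
lemma HasBetti.insert_of_ne_zero {f : κ → V →L[ℂ] ℂ} {c : κ → ℂ} {s : Finset κ} {H : κ}
    {P : Polynomial ℤ} (h : HasBetti f c s P) (hH : H ∉ s) (hne : ∀ x, f H x + c H ≠ 0) :
    HasBetti f c (insert H s) P := by
  have e : cpl f c s ⊆ cpl f c (insert H s) := fun x hx i hi => by
    rcases Finset.mem_insert.1 hi with rfl | hi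
    · exact hne x
    · exact hx i hi
  intro j
  let E := hmEquiv j (ContinuousMap.inclusion (cpl_insert_subset f c s H))
    (ContinuousMap.inclusion e) (ContinuousMap.Homotopic.refl _) (ContinuousMap.Homotopic.refl _)
  obtain ⟨h1, h2, h3⟩ := h j
  refine ⟨Module.Finite.equiv E.symm, by rw [E.finrank_eq, h2], ?_⟩
  refine Function.Injective.of_comp (f := hm j (resetCoord H)) ?_
  have : hm j (resetCoord H) ∘ hm j (toTorus f c (insert H s)) = hm j (toTorus f c s) ∘ E := by
    funext x
    refine (hm_comp _ _ _ _).symm.trans ?_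
    rw [resetCoord_toTorus f c hH]
    exact hm_comp _ _ _ _
  rw [this]
  exact h3.comp E.injective

/-- Adjoining the zero function empties the complement. -/
lemma HasBetti.insert_zero {f : κ → V →L[ℂ] ℂ} {c : κ → ℂ} {s : Finset κ} {H : κ}
    (hz : ∀ x, f H x + c H = 0) : HasBetti f c (insert H s) 0 := by
  have : IsEmpty (cpl f c (insert H s)) := ⟨fun x => x.2 H (Finset.mem_insert_self _ _) (hz _)⟩
  intro j
  have : Subsingleton (Hm j (cpl f c (insert H s))) :=
    ⟨fun x y => (hm_of_isEmpty j x).trans (hm_of_isEmpty j y).symm⟩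
  exact ⟨inferInstance, by simp [Module.finrank_zero_of_subsingleton],
    Function.injective_of_subsingleton _⟩

/-- The complement of the empty arrangement. -/
lemma hasBetti_empty (f : κ → V →L[ℂ] ℂ) (c : κ → ℂ) : HasBetti f c ∅ 1 := by
  intro j
  have h0 : (0 : V) ∈ cpl f c ∅ := by simp [cpl]
  let pt : C(cpl f c ∅, Unit) := ContinuousMap.const _ ()
  let z : C(Unit, cpl f c ∅) := ContinuousMap.const _ ⟨0, h0⟩
  have hz : (z.comp pt).Homotopic (ContinuousMap.id _) := by
    refine ⟨⟨⟨fun p => ⟨(p.1 : ℝ) • (p.2 : V), by simp [cpl]⟩, by fun_prop⟩, ?_, ?_⟩⟩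
    · exact fun x => Subtype.ext (by simp [z])
    · exact fun x => Subtype.ext (by simp)
  let E := hmEquiv j pt z (ContinuousMap.Homotopic.refl _) hz
  have hinj : Function.Injective (hm j (toTorus f c ∅)) := by
    refine Function.Injective.of_comp (f := hm j (ContinuousMap.const (κ → Cs) ())) ?_
    have : hm j (ContinuousMap.const (κ → Cs) ()) ∘ hm j (toTorus f c ∅) = E := by
      funext x
      exact (hm_comp _ _ _ _).symm
    rw [this]
    exact E.injective
  cases j with
  | zero =>
    obtain ⟨F⟩ := hmZeroOfUnique (X := Unit)
    exact ⟨Module.Finite.equiv (E.trans F).symm, by simp [(E.trans F).finrank_eq], hinj⟩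
  | succ j =>
    have : Subsingleton (Hm (j + 1) Unit) :=
      ⟨fun x y => (hm_succ_of_unique j x).trans (hm_succ_of_unique j y).symm⟩
    refine ⟨Module.Finite.equiv E.symm, ?_, hinj⟩
    rw [E.finrank_eq, Module.finrank_zero_of_subsingleton]
    simp [Polynomial.coeff_one]

/-- The data of a hyperplane `f H + c H = 0`, a point `x₀` on it and a transverse vector `v`. -/
structure Transversal (f : κ → V →L[ℂ] ℂ) (c : κ → ℂ) (H : κ) (x₀ v : V) : Prop where
  base : f H x₀ + c H = 0
  dir : f H v = 1

/-- The directions of the hyperplane. -/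
abbrev hyp (f : κ → V →L[ℂ] ℂ) (H : κ) : Submodule ℂ V := LinearMap.ker (f H).toLinearMap

/-- The restrictions of the linear parts to the hyperplane. -/
def resF (f : κ → V →L[ℂ] ℂ) (H : κ) : κ → hyp f H →L[ℂ] ℂ :=
  fun i => (f i).comp (hyp f H).subtypeL

/-- The restrictions of the constant parts to the hyperplane. -/
def resC (f : κ → V →L[ℂ] ℂ) (c : κ → ℂ) (x₀ : V) : κ → ℂ := fun i => f i x₀ + c i

namespace Transversal
variable {f : κ → V →L[ℂ] ℂ} {c : κ → ℂ} {s : Finset κ} {H : κ} {x₀ v : V}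

variable (f c H v) in
/-- The projection to the hyperplane, perturbed by a multiple of the distance to it. -/
def mv (r : ℂ) (y : V) : V := y - (f H y + c H) • v + (r * (f H y + c H)) • v

variable (f c s H v) in
/-- A tube around the complement inside the hyperplane. -/
def tube : Set V :=
  {y | ∀ K ∈ s, ‖(f H y + c H) * f K v‖ < ‖f K (mv f c H v 0 y) + c K‖}

lemma continuous_mv : Continuous fun p : ℂ × V => mv f c H v p.1 p.2 := by
  unfold mv
  fun_prop

lemma isOpen_tube : IsOpen (tube f c s H v) := by
  have : tube f c s H v = ⋂ K ∈ s,
      {y | ‖(f H y + c H) * f K v‖ < ‖f K (mv f c H v 0 y) + c K‖} := by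
    ext x
    simp [tube]
  rw [this]
  refine isOpen_biInter_finset fun K _ => isOpen_lt (by fun_prop) ?_
  unfold mv
  fun_prop

lemma mv_one (y : V) : mv f c H v 1 y = y := by simp [mv]

lemma mv_of_zero {y : V} (h : f H y + c H = 0) (r : ℂ) : mv f c H v r y = y := by simp [mv, h]

lemma apply_mv (K : κ) (r : ℂ) (y : V) :
    f K (mv f c H v r y) + c K = f K (mv f c H v 0 y) + c K + r * ((f H y + c H) * f K v) := by
  simp [mv]
  ring

lemma tube_subset : tube f c s H v ⊆ cpl f c s := by
  intro y hy K hK e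
  have h := hy K hK
  have := apply_mv (f := f) (c := c) (H := H) (v := v) K 1 y
  rw [mv_one, e, one_mul] at this
  rw [eq_neg_of_add_eq_zero_left this.symm, norm_neg] at h
  exact lt_irrefl _ h

lemma apply_mv_self (t : Transversal f c H x₀ v) (r : ℂ) (y : V) :
    f H (mv f c H v r y) + c H = r * (f H y + c H) := by
  simp [mv, t.dir]

lemma mv_mv (t : Transversal f c H x₀ v) (r r' : ℂ) (y : V) :
    mv f c H v r (mv f c H v r' y) = mv f c H v (r * r') y := by
  rw [mv, apply_mv_self t, mv, mv]
  module

lemma mv_mem_tube (t : Transversal f c H x₀ v) {r : ℂ} (hr : ‖r‖ ≤ 1) {y : V}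
    (hy : y ∈ tube f c s H v) :
    mv f c H v r y ∈ tube f c s H v := by
  intro K hK
  rw [apply_mv_self t, mv_mv t, zero_mul, mul_assoc, norm_mul]
  exact (mul_le_of_le_one_left (norm_nonneg _) hr).trans_lt (hy K hK)

lemma mv_zero_sub_mem (t : Transversal f c H x₀ v) (y : V) : mv f c H v 0 y - x₀ ∈ hyp f H := by
  have h := t.apply_mv_self 0 y
  have h2 := t.base
  have : f H (mv f c H v 0 y - x₀) = 0 := by
    rw [map_sub]
    linear_combination h - h2
  exact this

lemma apply_add (t : Transversal f c H x₀ v) (x : hyp f H) (r : ℂ) :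
    f H (x₀ + x + r • v) + c H = r := by
  have hx : f H x = 0 := x.2
  have h := t.base
  rw [map_add, map_add, map_smul, t.dir, hx, smul_eq_mul]
  linear_combination h

lemma mv_add (t : Transversal f c H x₀ v) (x : hyp f H) (r r' : ℂ) :
    mv f c H v r' (x₀ + x + r • v) = x₀ + x + (r' * r) • v := by
  rw [mv, t.apply_add]
  module

lemma add_mem_tube (t : Transversal f c H x₀ v) (x : hyp f H) {r : ℂ}
    (h : ∀ K ∈ s, ‖r * f K v‖ < ‖resF f H K x + resC f c x₀ K‖) :
    x₀ + x + r • v ∈ tube f c s H v := by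
  intro K hK
  rw [t.apply_add, t.mv_add, zero_mul, zero_smul, add_zero]
  convert h K hK using 2
  simp [resF, resC]
  ring

lemma mv_sub_mem_cpl (t : Transversal f c H x₀ v) {y : V} (hy : y ∈ tube f c s H v) :
    (⟨mv f c H v 0 y - x₀, t.mv_zero_sub_mem y⟩ : hyp f H) ∈ cpl (resF f H) (resC f c x₀) s := by
  intro K hK
  have h := (norm_nonneg _).trans_lt (hy K hK)
  rw [norm_pos_iff] at h
  convert h using 1
  simp [resF, resC]
  ring

/-- The projection of the tube to the hyperplane. -/
def tubeProj (t : Transversal f c H x₀ v) : C(tube f c s H v, cpl (resF f H) (resC f c x₀) s) where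
  toFun y := ⟨⟨mv f c H v 0 y - x₀, t.mv_zero_sub_mem y⟩, t.mv_sub_mem_cpl y.2⟩
  continuous_toFun := by
    have := (continuous_mv (f := f) (c := c) (H := H) (v := v)).comp
      (f := fun y : tube f c s H v => ((0 : ℂ), (y : V))) (by fun_prop)
    exact ((this.sub continuous_const).subtype_mk _).subtype_mk _

/-- The inclusion of the hyperplane in the tube. -/
def tubeIncl (t : Transversal f c H x₀ v) : C(cpl (resF f H) (resC f c x₀) s, tube f c s H v) where
  toFun x := ⟨x₀ + x.1 + (0 : ℂ) • v, t.add_mem_tube x.1 fun K hK => by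
    simpa using x.2 K hK⟩
  continuous_toFun := by fun_prop

/-- The tube retracts to the hyperplane. -/
def tubeEquiv (t : Transversal f c H x₀ v) (j : ℕ) :
    Hm j (tube f c s H v) ≃ₗ[ℚ] Hm j (cpl (resF f H) (resC f c x₀) s) := by
  refine hmEquiv j t.tubeProj t.tubeIncl ?_ ?_
  · have : t.tubeProj.comp t.tubeIncl = ContinuousMap.id (cpl (resF f H) (resC f c x₀) s) := by
      ext x
      simp only [ContinuousMap.comp_apply, tubeProj, tubeIncl, ContinuousMap.coe_mk, t.mv_add]
      simp
    rw [this]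
  · refine ⟨⟨⟨fun p => ⟨mv f c H v ((p.1 : ℝ) : ℂ) p.2, t.mv_mem_tube ?_ p.2.2⟩, ?_⟩, ?_, ?_⟩⟩
    · rw [Complex.norm_real, Real.norm_of_nonneg p.1.2.1]
      exact p.1.2.2
    · exact (continuous_mv.comp (f := fun p : unitInterval × tube f c s H v =>
        (((p.1 : ℝ) : ℂ), (p.2 : V))) (by fun_prop)).subtype_mk _
    · exact fun x => Subtype.ext (by simp [tubeProj, tubeIncl])
    · exact fun x => Subtype.ext (by simp [mv_one])

end Transversal
end
end

noncomputable section

namespace Transversal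
variable {κ V : Type} [NormedAddCommGroup V] [NormedSpace ℂ V]
  {f : κ → V →L[ℂ] ℂ} {c : κ → ℂ} {s : Finset κ} {H : κ} {x₀ v : V}

variable (f c s H v) in
/-- The tube with the hyperplane removed. -/
def ptube : Set V := cpl f c (insert H s) ∩ tube f c s H v

lemma mem_ptube {y : V} : y ∈ ptube f c s H v ↔ y ∈ tube f c s H v ∧ f H y + c H ≠ 0 := by
  refine ⟨fun h => ⟨h.2, h.1 H (Finset.mem_insert_self _ _)⟩, fun h => ⟨fun i hi => ?_, h.1⟩⟩
  rcases Finset.mem_insert.1 hi with rfl | hi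
  · exact h.2
  · exact tube_subset h.1 i hi

variable (f c s H v) in
lemma ptube_left : ptube f c s H v ⊆ cpl f c (insert H s) := Set.inter_subset_left

variable (f c s H v) in
lemma ptube_right : ptube f c s H v ⊆ tube f c s H v := Set.inter_subset_right

lemma cpl_eq_union : cpl f c s = cpl f c (insert H s) ∪ tube f c s H v := by
  refine (Set.union_subset (cpl_insert_subset f c s H) tube_subset).antisymm' fun y hy => ?_
  by_cases h : f H y + c H = 0
  · refine Or.inr fun K hK => ?_
    rw [h, zero_mul, norm_zero, mv_of_zero h]
    exact norm_pos_iff.2 (hy K hK)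
  · refine Or.inl fun i hi => ?_
    rcases Finset.mem_insert.1 hi with rfl | hi
    · exact h
    · exact hy i hi

variable (f c s H v) in
lemma mvSq : MVSq
    (ContinuousMap.inclusion (ptube_left f c s H v))
    (ContinuousMap.inclusion (ptube_right f c s H v))
    (ContinuousMap.inclusion (cpl_insert_subset f c s H))
    (ContinuousMap.inclusion (tube_subset : tube f c s H v ⊆ cpl f c s)) :=
  MVSq.ofSets (isOpen_cpl _ _ _) isOpen_tube cpl_eq_union rfl _ _ _ _

variable (f c s H v) in
/-- The value of the function defining the hyperplane. -/
def height : C(ptube f c s H v, Cs) where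
  toFun y := ⟨f H y + c H, (mem_ptube.1 y.2).2⟩
  continuous_toFun := by fun_prop

variable (f H v s) in
/-- A factor that scales `z` so that `z • v` moves no `g K` to zero. -/
def scale (g : κ → ℂ) (z : ℂ) : ℝ := (1 + ∑ K ∈ s, ‖z * f K v‖ / ‖g K‖)⁻¹

lemma one_le_scale_inv (g : κ → ℂ) (z : ℂ) : 1 ≤ 1 + ∑ K ∈ s, ‖z * f K v‖ / ‖g K‖ :=
  le_add_of_nonneg_right (Finset.sum_nonneg fun _ _ => by positivity)

lemma scale_pos (g : κ → ℂ) (z : ℂ) : 0 < scale f s v g z :=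
  inv_pos.2 (zero_lt_one.trans_le (one_le_scale_inv g z))

lemma scale_le_one (g : κ → ℂ) (z : ℂ) : scale f s v g z ≤ 1 :=
  inv_le_one_of_one_le₀ (one_le_scale_inv g z)

lemma scale_spec {g : κ → ℂ} (z : ℂ) {K : κ} (hK : K ∈ s) (hg : g K ≠ 0) :
    ‖((scale f s v g z : ℝ) : ℂ) * z * f K v‖ < ‖g K‖ := by
  rw [mul_assoc, norm_mul, Complex.norm_real, Real.norm_of_nonneg (scale_pos _ _).le, scale,
    inv_mul_lt_iff₀ (zero_lt_one.trans_le (one_le_scale_inv g z)),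
    ← div_lt_iff₀ (norm_pos_iff.2 hg)]
  have := Finset.single_le_sum (f := fun K => ‖z * f K v‖ / ‖g K‖) (fun _ _ => by positivity) hK
  linarith

lemma interp_pos {d : ℝ} (hd : 0 < d) (r : unitInterval) : 0 < (1 - (r : ℝ)) * d + r := by
  have h0 := r.2.1
  have h1 := r.2.2
  rcases h0.eq_or_lt with h | h
  · rw [← h]
    linarith
  · nlinarith

lemma interp_le_one {d : ℝ} (hd : d ≤ 1) (r : unitInterval) : (1 - (r : ℝ)) * d + r ≤ 1 := by
  nlinarith [r.2.1, r.2.2]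

variable (f c s H x₀ v) in
/-- The scaling factor on the trivialised punctured tube. -/
def scaleMap : C(cpl (resF f H) (resC f c x₀) s × Cs, ℝ) where
  toFun p := scale f s v (fun K => resF f H K p.1 + resC f c x₀ K) p.2
  continuous_toFun := by
    refine Continuous.inv₀ (continuous_const.add (continuous_finsetSum _ fun K hK => ?_))
      fun p => (zero_lt_one.trans_le (one_le_scale_inv _ _)).ne'
    exact Continuous.div (by fun_prop) (by fun_prop) fun p => norm_ne_zero_iff.2 (p.1.2 K hK)

lemma mv_mem_ptube (t : Transversal f c H x₀ v) {r : ℝ} (hr : 0 < r) (hr' : r ≤ 1) {y : V}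
    (hy : y ∈ ptube f c s H v) :
    mv f c H v r y ∈ ptube f c s H v := by
  obtain ⟨h1, h2⟩ := mem_ptube.1 hy
  refine mem_ptube.2 ⟨t.mv_mem_tube ?_ h1, ?_⟩
  · rwa [Complex.norm_real, Real.norm_of_nonneg hr.le]
  · rw [t.apply_mv_self]
    exact mul_ne_zero (by exact_mod_cast hr.ne') h2

/-- The trivialisation of the punctured tube. -/
def ptubeProj (t : Transversal f c H x₀ v) :
    C(ptube f c s H v, cpl (resF f H) (resC f c x₀) s × Cs) :=
  (t.tubeProj.comp (ContinuousMap.inclusion (ptube_right f c s H v))).prodMk (height f c s H v)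

lemma incl_mem_ptube (t : Transversal f c H x₀ v) (p : cpl (resF f H) (resC f c x₀) s × Cs) :
    x₀ + p.1.1 + (((scaleMap f c s H x₀ v p : ℝ) : ℂ) * p.2.1) • v ∈ ptube f c s H v := by
  refine mem_ptube.2 ⟨t.add_mem_tube _ fun K hK => scale_spec _ hK (p.1.2 K hK), ?_⟩
  rw [t.apply_add]
  exact mul_ne_zero (by exact_mod_cast (scale_pos _ _).ne') p.2.2

/-- The homotopy inverse of the trivialisation of the punctured tube. -/
def ptubeIncl (t : Transversal f c H x₀ v) :
    C(cpl (resF f H) (resC f c x₀) s × Cs, ptube f c s H v) where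
  toFun p := ⟨_, t.incl_mem_ptube p⟩
  continuous_toFun := by fun_prop

lemma tubeProj_incl (t : Transversal f c H x₀ v) (p : cpl (resF f H) (resC f c x₀) s × Cs) :
    t.tubeProj ⟨_, (t.incl_mem_ptube p).2⟩ = p.1 := by
  ext
  simp only [tubeProj, ContinuousMap.coe_mk, t.mv_add]
  simp

/-- The punctured tube is a product up to homotopy. -/
def ptubeEquiv (t : Transversal f c H x₀ v) (j : ℕ) :
    Hm j (ptube f c s H v) ≃ₗ[ℚ] Hm j (cpl (resF f H) (resC f c x₀) s × Cs) := by
  refine hmEquiv j t.ptubeProj t.ptubeIncl ?_ ?_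
  · refine ⟨⟨⟨fun p => (p.2.1,
      ⟨(((1 - (p.1 : ℝ)) * scaleMap f c s H x₀ v p.2 + p.1 : ℝ) : ℂ) * p.2.2.1,
      mul_ne_zero ?_ p.2.2.2⟩), ?_⟩, ?_, ?_⟩⟩
    · exact_mod_cast (interp_pos (scale_pos _ _) p.1).ne'
    · fun_prop
    · intro p
      refine Prod.ext (t.tubeProj_incl p).symm (Subtype.ext ?_)
      refine Eq.trans ?_ (t.apply_add _ _).symm
      simp
    · exact fun p => Prod.ext rfl (Subtype.ext (by simp))
  · refine ⟨⟨⟨fun p => ⟨mv f c H v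
      (((1 - (p.1 : ℝ)) * scaleMap f c s H x₀ v (t.ptubeProj p.2) + p.1 : ℝ) : ℂ) p.2,
      t.mv_mem_ptube (interp_pos (scale_pos _ _) p.1) (interp_le_one (scale_le_one _ _) p.1) p.2.2⟩,
      ?_⟩, ?_, ?_⟩⟩
    · exact (continuous_mv.comp (f := fun p : unitInterval × ptube f c s H v =>
        ((((1 - (p.1 : ℝ)) * scaleMap f c s H x₀ v (t.ptubeProj p.2) + p.1 : ℝ) : ℂ), (p.2 : V)))
        (by fun_prop)).subtype_mk _
    · refine fun x => Subtype.ext ?_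
      simp [ptubeIncl, ptubeProj, tubeProj, height, mv, ContinuousMap.inclusion]
    · exact fun x => Subtype.ext (by simp [mv_one])

lemma splitCoord_homotopic (t : Transversal f c H x₀ v) (hH : H ∉ s) :
    (((splitCoord H).comp (toTorus f c (insert H s))).comp
      (ContinuousMap.inclusion (ptube_left f c s H v))).Homotopic
    (((toTorus (resF f H) (resC f c x₀) s).prodMap (ContinuousMap.id Cs)).comp t.ptubeProj) := by
  have hr (p : unitInterval × ptube f c s H v) :
      mv f c H v (((1 - p.1 : ℝ)) : ℂ) p.2 ∈ cpl f c s := by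
    refine tube_subset (t.mv_mem_tube ?_ p.2.2.2)
    rw [Complex.norm_real, Real.norm_of_nonneg (by linarith [p.1.2.2])]
    linarith [p.1.2.1]
  refine ⟨⟨⟨fun p => (toTorus f c s ⟨_, hr p⟩, height f c s H v p.2), ?_⟩, ?_, ?_⟩⟩
  · have := (continuous_mv (f := f) (c := c) (H := H) (v := v)).comp
      (f := fun p : unitInterval × ptube f c s H v => (((1 - p.1 : ℝ) : ℂ), (p.2 : V)))
      (by fun_prop)
    exact ((map_continuous _).comp (this.subtype_mk hr)).prodMk
      ((map_continuous _).comp continuous_snd)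
  · intro x
    refine Prod.ext ?_ (Subtype.ext ?_)
    · refine Eq.trans ?_ (congrArg (fun g : C(cpl f c (insert H s), κ → Cs) => g ⟨x.1, x.2.1⟩)
        (resetCoord_toTorus f c hH)).symm
      refine congrArg (toTorus f c s) (Subtype.ext ?_)
      simp [mv_one, ContinuousMap.inclusion]
    · simp [splitCoord, toTorus, height, ContinuousMap.inclusion]
  · intro x
    refine Prod.ext (funext fun i => Subtype.ext ?_) rfl
    by_cases hi : i ∈ s
    · change (toTorus f c s _ i : ℂ) =
        toTorus (resF f H) (resC f c x₀) s (t.tubeProj ⟨x, x.2.2⟩) i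
      simp [toTorus, hi, tubeProj, resF, resC]
      ring
    · change (toTorus f c s _ i : ℂ) =
        toTorus (resF f H) (resC f c x₀) s (t.tubeProj ⟨x, x.2.2⟩) i
      simp [toTorus, hi]

lemma incl_injective (t : Transversal f c H x₀ v) (hH : H ∉ s)
    (h : ∀ j, Function.Injective (hm j (toTorus (resF f H) (resC f c x₀) s))) (j : ℕ) :
    Function.Injective (hm j (((splitCoord H).comp (toTorus f c (insert H s))).comp
      (ContinuousMap.inclusion (ptube_left f c s H v)))) := by
  rw [hm_eq_of_homotopic j (t.splitCoord_homotopic hH)]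
  have : (hm j (((toTorus (resF f H) (resC f c x₀) s).prodMap (ContinuousMap.id Cs)).comp
      t.ptubeProj) : _ → _) = hm j _ ∘ t.ptubeEquiv j := funext fun x => hm_comp _ _ _ _
  rw [this]
  exact (prod_Cs_injective h j).comp (t.ptubeEquiv j).injective

/-- Deletion and restriction. -/
lemma hasBetti_insert (t : Transversal f c H x₀ v) (hH : H ∉ s) {P P' : Polynomial ℤ}
    (h : HasBetti f c s P)
    (h' : HasBetti (resF f H) (resC f c x₀) s P') :
    HasBetti f c (insert H s) (P + Polynomial.X * P') := by
  have key (j : ℕ) (z : Hm j (ptube f c s H v)) (hz : hm j (toTorus f c (insert H s))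
      (hm j (ContinuousMap.inclusion (ptube_left f c s H v)) z) = 0) :
      z = 0 := by
    refine t.incl_injective hH (fun j => (h' j).2.2) j (Eq.trans ?_ (map_zero _).symm)
    rw [hm_comp, hm_comp, hz, map_zero]
  have sq := mvSq f c s H v
  have inj (j z) (hz : hm j (ContinuousMap.inclusion
      (ptube_left f c s H v)) z = 0)
      (_ : hm j (ContinuousMap.inclusion
        (ptube_right f c s H v)) z = 0) : z = 0 :=
    key j z (by rw [hz, map_zero])
  have fT (j : ℕ) : Module.Finite ℚ (Hm j (cpl (resF f H) (resC f c x₀) s)) := (h' j).1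
  have fN (j : ℕ) : Module.Finite ℚ (Hm j (tube f c s H v)) :=
    Module.Finite.equiv (t.tubeEquiv j).symm
  have fE (j : ℕ) : Module.Finite ℚ (Hm j (cpl f c s)) := (h j).1
  have fA (j : ℕ) : Module.Finite ℚ (Hm j (ptube f c s H v)) := by
    have : Module.Finite ℚ (Hm j (cpl (resF f H) (resC f c x₀) s × Cs)) := by
      cases j with
      | zero => exact Module.Finite.equiv (hmZeroCs _)
      | succ j => exact finite_prod_Cs_succ _ j
    exact Module.Finite.equiv (t.ptubeEquiv j).symm
  have fB (j : ℕ) : Module.Finite ℚ (Hm j (cpl f c (insert H s))) := sq.finite_left inj j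
  intro j
  refine ⟨fB j, ?_, (injective_iff_map_eq_zero _).2 fun z hz => ?_⟩
  · have e := sq.finrank_add inj j
    rw [(t.tubeEquiv j).finrank_eq, (t.ptubeEquiv j).finrank_eq] at e
    have e2 := (h j).2.1
    have e3 := (h' j).2.1
    rw [Polynomial.coeff_add, ← e2]
    cases j with
    | zero =>
      rw [← (hmZeroCs _).finrank_eq] at e
      rw [Polynomial.coeff_X_mul_zero]
      omega
    | succ j =>
      have e4 := (h' j).2.1
      rw [finrank_prod_Cs_succ] at e
      rw [Polynomial.coeff_X_mul, ← e4]
      omega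
  · have hz' : hm j (ContinuousMap.inclusion (cpl_insert_subset f c s H)) z = 0 := by
      refine (h j).2.2 (Eq.trans ?_ (map_zero _).symm)
      rw [← hm_comp, ← resetCoord_toTorus f c hH, hm_comp, hz, map_zero]
    obtain ⟨w, rfl, -⟩ := sq.exists_of_eq j z 0 (hz'.trans (map_zero _).symm)
    rw [key j w hz, map_zero]

end Transversal
end

noncomputable section

section
variable {κ : Type} {V : Type} [NormedAddCommGroup V] [NormedSpace ℂ V]

/-- The common zeros of the affine functions `f i + c i` for `i ∈ S`. -/
def flat (f : κ → V →L[ℂ] ℂ) (c : κ → ℂ) (S : Finset κ) : Set V :=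
  {x | ∀ i ∈ S, f i x + c i = 0}

/-- The summand of Whitney's formula given by a set of hyperplanes. -/
def whitneyTerm (f : κ → V →L[ℂ] ℂ) (c : κ → ℂ) (S : Finset κ) : Polynomial ℤ :=
  if (flat f c S).Nonempty then
    (-1) ^ S.card * (-Polynomial.X) ^ rkIn ℂ Set.univ (flat f c S) else 0

/-- The Poincaré polynomial by Whitney's formula. -/
def whitney (f : κ → V →L[ℂ] ℂ) (c : κ → ℂ) (s : Finset κ) : Polynomial ℤ :=
  ∑ S ∈ s.powerset, whitneyTerm f c S

lemma whitney_insert (f : κ → V →L[ℂ] ℂ) (c : κ → ℂ) {s : Finset κ} {H : κ} (hH : H ∉ s) :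
    whitney f c (insert H s) = whitney f c s + ∑ S ∈ s.powerset, whitneyTerm f c (insert H S) :=
  Finset.sum_powerset_insert hH _

lemma flat_insert (f : κ → V →L[ℂ] ℂ) (c : κ → ℂ) (S : Finset κ) (H : κ) :
    flat f c (insert H S) = {x | f H x + c H = 0} ∩ flat f c S := by
  ext x
  simp [flat]

lemma flatDim_univ : flatDim ℂ (Set.univ : Set V) = Module.finrank ℂ V := by
  rw [flatDim, AffineSubspace.span_univ, AffineSubspace.direction_top, finrank_top]

lemma flatDim_le [FiniteDimensional ℂ V] (X : Set V) : flatDim ℂ X ≤ Module.finrank ℂ V :=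
  Submodule.finrank_le _

lemma flatDim_image {W : Type} [NormedAddCommGroup W] [NormedSpace ℂ W] (g : W →ᵃ[ℂ] V)
    (hg : Function.Injective g) (X : Set W) : flatDim ℂ (g '' X) = flatDim ℂ X := by
  rw [flatDim, flatDim, ← AffineSubspace.map_span, AffineSubspace.map_direction]
  exact (Submodule.equivMapOfInjective _ (g.linear_injective_iff.2 hg) _).finrank_eq.symm

namespace Transversal
variable {f : κ → V →L[ℂ] ℂ} {c : κ → ℂ} {H : κ} {x₀ v : V}

variable (f H x₀) in
/-- The inclusion of a hyperplane. -/
def inclHyp : hyp f H →ᵃ[ℂ] V where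
  toFun x := x₀ + x
  linear := (hyp f H).subtype
  map_vadd' p w := by
    simp only [vadd_eq_add, Submodule.coe_add, Submodule.subtype_apply]
    abel

lemma inclHyp_injective : Function.Injective (inclHyp f H x₀) :=
  fun _ _ h => Subtype.ext (add_left_cancel h)

lemma flat_insert (t : Transversal f c H x₀ v) (S : Finset κ) :
    flat f c (insert H S) = inclHyp f H x₀ '' flat (resF f H) (resC f c x₀) S := by
  have e (i : κ) (y : hyp f H) : resF f H i y + resC f c x₀ i = f i (x₀ + y) + c i := by
    simp [resF, resC]
    ring
  rw [_root_.flat_insert]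
  ext x
  constructor
  · rintro ⟨h1 : f H x + c H = 0, h2⟩
    have hx : f H (x - x₀) = 0 := by
      rw [map_sub]
      linear_combination h1 - t.base
    refine ⟨⟨x - x₀, hx⟩, fun i hi => ?_, add_sub_cancel x₀ x⟩
    rw [e, add_sub_cancel]
    exact h2 i hi
  · rintro ⟨y, hy, rfl⟩
    refine ⟨?_, fun i hi => (e i y).symm.trans (hy i hi)⟩
    have := t.apply_add y 0
    rwa [zero_smul, add_zero] at this

lemma finrank_eq [FiniteDimensional ℂ V] (t : Transversal f c H x₀ v) :
    Module.finrank ℂ V = Module.finrank ℂ (hyp f H) + 1 := by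
  have h := LinearMap.finrank_range_add_finrank_ker (f H).toLinearMap
  rw [LinearMap.range_eq_top.2, finrank_top, Module.finrank_self] at h
  · rw [← h, add_comm]
  · intro z
    exact ⟨z • v, by simp [t.dir]⟩

lemma whitneyTerm_insert [FiniteDimensional ℂ V] (t : Transversal f c H x₀ v) {S : Finset κ}
    (hS : H ∉ S) : whitneyTerm f c (insert H S) =
      Polynomial.X * whitneyTerm (resF f H) (resC f c x₀) S := by
  rw [whitneyTerm, whitneyTerm, t.flat_insert, Set.image_nonempty]
  split_ifs
  · have h := flatDim_le (flat (resF f H) (resC f c x₀) S)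
    rw [rkIn, rkIn, flatDim_univ, flatDim_univ, flatDim_image _ inclHyp_injective, t.finrank_eq,
      Nat.sub_add_comm h, Finset.card_insert_of_notMem hS]
    ring
  · simp

end Transversal

/-- The homology of the complement of an arrangement, computed by Whitney's formula. -/
theorem hasBetti_whitney (s : Finset κ) : ∀ {V : Type} [NormedAddCommGroup V] [NormedSpace ℂ V]
    [FiniteDimensional ℂ V] (f : κ → V →L[ℂ] ℂ) (c : κ → ℂ), HasBetti f c s (whitney f c s) := by
  induction s using Finset.induction_on with
  | empty =>
    intro V _ _ _ f c
    convert hasBetti_empty f c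
    have : flat f c ∅ = Set.univ := by simp [flat]
    simp [whitney, whitneyTerm, this, rkIn]
  | insert H s hH ih =>
    intro V _ _ _ f c
    have hS {S : Finset κ} (h : S ∈ s.powerset) : H ∉ S := fun h' => hH (Finset.mem_powerset.1 h h')
    rw [whitney_insert f c hH]
    by_cases hf : f H = 0
    · by_cases hc : c H = 0
      · convert HasBetti.insert_zero (f := f) (c := c) (s := s) (H := H) (by simp [hf, hc])
        rw [whitney, ← Finset.sum_add_distrib]
        refine Finset.sum_eq_zero fun S h => ?_
        have : flat f c (insert H S) = flat f c S := by simp [flat_insert, hf, hc]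
        rw [whitneyTerm, whitneyTerm, this, Finset.card_insert_of_notMem (hS h)]
        split_ifs <;> ring
      · convert (ih f c).insert_of_ne_zero hH (by simp [hf, hc])
        rw [Finset.sum_eq_zero, add_zero]
        intro S _
        have : flat f c (insert H S) = ∅ := by simp [flat_insert, hf, hc]
        simp [whitneyTerm, this]
    · obtain ⟨u, hu⟩ : ∃ u, f H u ≠ 0 := by
        by_contra! h
        exact hf (ContinuousLinearMap.ext h)
      have t : Transversal f c H (-(c H / f H u) • u) ((f H u)⁻¹ • u) :=
        ⟨by simp [hu], by simp [hu]⟩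
      convert t.hasBetti_insert hH (ih f c) (ih _ _) using 2
      rw [whitney, Finset.mul_sum]
      exact Finset.sum_congr rfl fun S h => t.whitneyTerm_insert (hS h)
end
end

noncomputable section

section
variable {V : Type}

/-- The alternating count of the subfamilies of `A` with a given intersection. -/
def crossCut (A : Finset (Set V)) (X : Set V) : ℤ :=
  ∑ S ∈ A.powerset.filter fun S => Set.univ ∩ ⋂ H ∈ S, H = X, (-1) ^ S.card

lemma mem_interPosetIn {A S : Finset (Set V)} (hS : S ⊆ A)
    (h : (Set.univ ∩ ⋂ H ∈ S, H : Set V).Nonempty) :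
    Set.univ ∩ ⋂ H ∈ S, H ∈ interPosetIn Set.univ A :=
  Finset.mem_filter.2 ⟨Finset.mem_image_of_mem _ (Finset.mem_powerset.2 hS), h⟩

lemma isMobiusIn_crossCut [AddCommGroup V] [Module ℂ V] {A : Finset (Set V)}
    (hA : ∀ H ∈ A, IsHyperplane ℂ H) :
    IsMobiusIn Set.univ A (crossCut A) := by
  intro X hX
  obtain ⟨hX, hne⟩ := Finset.mem_filter.1 hX
  obtain ⟨S₀, hS₀, hXS⟩ := Finset.mem_image.1 hX
  rw [Finset.mem_powerset] at hS₀
  have e : (∑ Y ∈ (interPosetIn Set.univ A).filter (X ⊆ ·), crossCut A Y) =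
      ∑ S ∈ (A.filter (X ⊆ ·)).powerset, (-1 : ℤ) ^ S.card := by
    rw [← Finset.sum_fiberwise_of_maps_to (s := (A.filter (X ⊆ ·)).powerset)
      (t := (interPosetIn Set.univ A).filter (X ⊆ ·)) (g := fun S => Set.univ ∩ ⋂ H ∈ S, H)]
    · refine Finset.sum_congr rfl fun Y hY => Finset.sum_congr ?_ fun _ _ => rfl
      ext S
      simp only [Finset.mem_filter, Finset.mem_powerset]
      refine and_congr_left fun hSY => ⟨fun hS H hH => ?_, fun hS =>
        hS.trans (Finset.filter_subset _ _)⟩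
      refine Finset.mem_filter.2 ⟨hS hH, (Finset.mem_filter.1 hY).2.trans ?_⟩
      rw [← hSY]
      exact Set.inter_subset_right.trans (Set.biInter_subset_of_mem hH)
    · intro S hS
      rw [Finset.mem_powerset] at hS
      have hsub : X ⊆ Set.univ ∩ ⋂ H ∈ S, H := Set.subset_inter (Set.subset_univ _)
        (Set.subset_iInter₂ fun H hH => (Finset.mem_filter.1 (hS hH)).2)
      exact Finset.mem_filter.2 ⟨mem_interPosetIn (hS.trans (Finset.filter_subset _ _))
        (hne.mono hsub), hsub⟩
  rw [e, Finset.sum_powerset_neg_one_pow_card]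
  refine if_congr ?_ rfl rfl
  constructor
  · intro h
    have : S₀ = ∅ := by
      refine Finset.subset_empty.1 (h ▸ fun H hH => Finset.mem_filter.2 ⟨hS₀ hH, ?_⟩)
      rw [← hXS]
      exact Set.inter_subset_right.trans (Set.biInter_subset_of_mem hH)
    rw [← hXS, this]
    simp
  · rintro rfl
    refine Finset.filter_eq_empty_iff.2 fun H hH hu => ?_
    obtain ⟨f, c, hf, rfl⟩ := hA H hH
    have h (x : V) : f x = c := hu (Set.mem_univ x)
    exact hf (LinearMap.ext fun x => (h x).trans ((h 0).symm.trans (map_zero f)))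

/-- The recursion determines the Möbius function. -/
lemma IsMobiusIn.unique {W : Set V} {A : Finset (Set V)} {μ ν : Set V → ℤ}
    (hμ : IsMobiusIn W A μ) (hν : IsMobiusIn W A ν) {X : Set V} (hX : X ∈ interPosetIn W A) :
    μ X = ν X := by
  by_contra hne
  obtain ⟨Y, hY⟩ := ((interPosetIn W A).filter fun X => μ X ≠ ν X).exists_maximal
    ⟨X, Finset.mem_filter.2 ⟨hX, hne⟩⟩
  obtain ⟨hYA, hYne⟩ := Finset.mem_filter.1 hY.prop
  have h := (hμ Y hYA).trans (hν Y hYA).symm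
  have hmem : Y ∈ (interPosetIn W A).filter (Y ⊆ ·) :=
    Finset.mem_filter.2 ⟨hYA, subset_rfl⟩
  rw [← Finset.add_sum_erase _ μ hmem, ← Finset.add_sum_erase _ ν hmem] at h
  refine hYne (add_right_cancel (h.trans (congrArg _ (Finset.sum_congr rfl fun Z hZ => ?_))))
  obtain ⟨hZY, hZ⟩ := Finset.mem_erase.1 hZ
  obtain ⟨hZA, hYZ⟩ := Finset.mem_filter.1 hZ
  by_contra hc
  exact hZY ((hY.le_of_ge (Finset.mem_filter.2 ⟨hZA, fun e => hc e.symm⟩) hYZ).antisymm hYZ)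
end

section
variable {V : Type} [NormedAddCommGroup V] [NormedSpace ℂ V]

lemma poinIn_eq_whitney {A : Finset (Set V)} (hA : ∀ H ∈ A, IsHyperplane ℂ H) {μ : Set V → ℤ}
    (hμ : IsMobiusIn Set.univ A μ) {f : Set V → V →L[ℂ] ℂ} {c : Set V → ℂ}
    (hf : ∀ H ∈ A, H = {x | f H x + c H = 0}) :
    poinIn ℂ Set.univ A μ = whitney f c A := by
  have hflat {S : Finset (Set V)} (hS : S ∈ A.powerset) :
      flat f c S = Set.univ ∩ ⋂ H ∈ S, H := by
    ext x
    simp only [flat, Set.univ_inter, Set.mem_iInter]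
    exact forall₂_congr fun H hH => (Set.ext_iff.1 (hf H (Finset.mem_powerset.1 hS hH)) x).symm
  have hw : whitney f c A = ∑ S ∈ A.powerset, if (Set.univ ∩ ⋂ H ∈ S, H : Set V).Nonempty then
      (-1) ^ S.card * (-Polynomial.X) ^ rkIn ℂ Set.univ (Set.univ ∩ ⋂ H ∈ S, H : Set V) else 0 :=
    Finset.sum_congr rfl fun S hS => by rw [whitneyTerm, hflat hS]
  rw [hw, poinIn, ← Finset.sum_filter]
  refine Eq.trans ?_ (Finset.sum_fiberwise_of_maps_to (t := interPosetIn Set.univ A)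
    (g := fun S : Finset (Set V) => Set.univ ∩ ⋂ H ∈ S, H) ?_ _)
  · refine Finset.sum_congr rfl fun X hX => ?_
    rw [hμ.unique (isMobiusIn_crossCut hA) hX, crossCut, map_sum, Finset.sum_mul,
      Finset.filter_filter]
    refine Finset.sum_congr (Finset.filter_congr fun S _ => ?_) fun S hS => ?_
    · exact ⟨fun h => ⟨h ▸ (Finset.mem_filter.1 hX).2, h⟩, fun h => h.2⟩
    · rw [(Finset.mem_filter.1 hS).2.2]
      simp
  · intro S hS
    obtain ⟨h1, h2⟩ := Finset.mem_filter.1 hS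
    exact mem_interPosetIn (Finset.mem_powerset.1 h1) h2
end
end

/-- For a finite arrangement `A` of affine hyperplanes in `ℂ^ℓ`, the
`i`-th Betti number of the complement `M(A)` (the `ℚ`-dimension of its `i`-th singular
homology with rational coefficients) equals the combinatorially defined `b_i(A)`,
i.e. the coefficient of `t^i` in `π(A,t)`. -/
theorem betti_numbers_of_complement {ℓ : ℕ} (A : Finset (Set (Fin ℓ → ℂ)))
    (hA : ∀ H ∈ A, IsHyperplane ℂ H)
    (μ : Set (Fin ℓ → ℂ) → ℤ) (hμ : IsMobiusIn Set.univ A μ) (i : ℕ) :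
    (Module.finrank ℚ
        ((singularHomologyFunctor ℚ i).obj
          (TopCat.of ((⋃ H ∈ A, (H : Set (Fin ℓ → ℂ)))ᶜ : Set (Fin ℓ → ℂ)))) : ℤ)
      = (poinIn ℂ Set.univ A μ).coeff i := by
  have key (H : Set (Fin ℓ → ℂ)) : ∃ (f : (Fin ℓ → ℂ) →L[ℂ] ℂ) (c : ℂ),
      H ∈ A → H = {x | f x + c = 0} := by
    by_cases h : H ∈ A
    · obtain ⟨f, c, -, rfl⟩ := hA H h
      refine ⟨LinearMap.toContinuousLinearMap f, -c, fun _ => ?_⟩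
      ext x
      simp [add_neg_eq_zero]
    · exact ⟨0, 0, fun h' => absurd h' h⟩
  choose f c hf using key
  have hM : ((⋃ H ∈ A, (H : Set (Fin ℓ → ℂ)))ᶜ : Set (Fin ℓ → ℂ)) = cpl f c A := by
    ext x
    simp only [Set.mem_compl_iff, Set.mem_iUnion, not_exists, cpl]
    exact forall₂_congr fun H hH => not_congr (Set.ext_iff.1 (hf H hH) x)
  rw [poinIn_eq_whitney hA hμ hf, ← (hasBetti_whitney A f c i).2.1, hM]
  exact congrArg _ ((sgHomIso i).app (TopCat.of (cpl f c A))).symm.toLinearEquiv.finrank_eq
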